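/- arXiv:0812.3326 — 2 statements merged into one kernel-verified Lean document; each statement's English description precedes it below -/
import Mathlib

section
/- There exists a constant C > 0 (depending only on the distribution of ξ) such that for all integers k ≥ 1 and n ≥ 1 (with P(|𝒯| = n) > 0), E Q_k(T_n) ≤ C k √n. -/
open scoped ENNReal BigOperators
open Set Filter

/-- Plane (ordered rooted) trees. -/
inductive PlaneTree : Type
  | node : List PlaneTree → PlaneTree

namespace PlaneTree

/-- The list of subtrees hanging off the root. -/
def children : PlaneTree → List PlaneTree
  | .node ts => ts

/-- The subtree rooted at a given position (sequence of child indices), if it exists. -/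
def subtreeAt : PlaneTree → List ℕ → Option PlaneTree
  | t, [] => some t
  | .node ts, i :: q =>
    match ts[i]? with
    | some t' => subtreeAt t' q
    | none => none

/-- The vertex set of a tree, with vertices identified with their positions. -/
def vertexSet (t : PlaneTree) : Set (List ℕ) := {q | (subtreeAt t q).isSome}

/-- The number of vertices of a tree. -/
noncomputable def size (t : PlaneTree) : ℕ := (vertexSet t).ncard

/-- The number of children of the vertex at position `q`. -/
def childCount (t : PlaneTree) (q : List ℕ) : ℕ :=
  ((subtreeAt t q).map fun t' => t'.children.length).getD 0

end PlaneTree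

/-- Longest common prefix of two positions; this is the position of the last common
ancestor of the two vertices. -/
def lca : List ℕ → List ℕ → List ℕ
  | a :: as, b :: bs => if a = b then a :: lca as bs else []
  | _, _ => []

/-- The distance from `v` up to the last common ancestor of `v` and `w`. -/
def dUp (v w : List ℕ) : ℕ := v.length - (lca v w).length

/-- The graph distance between the vertices at positions `v` and `w`. -/
def treeDist (v w : List ℕ) : ℕ := dUp v w + dUp w v

/-- The Galton–Watson probability of a given finite tree: the product, over all vertices,
of the probability that the offspring distribution takes the value given by the number of
children of the vertex. -/
noncomputable def gwProb (p : ℕ → ℝ≥0∞) (t : PlaneTree) : ℝ≥0∞ :=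
  ∏ᶠ v ∈ PlaneTree.vertexSet t, p (PlaneTree.childCount t v)

/-- `P(|𝒯| = n)` for the Galton–Watson tree `𝒯`. -/
noncomputable def probSize (p : ℕ → ℝ≥0∞) (n : ℕ) : ℝ≥0∞ :=
  ∑' t : PlaneTree, if PlaneTree.size t = n then gwProb p t else 0

/-- `E f(T_n)` where `T_n` is the Galton–Watson tree conditioned to have `n` vertices. -/
noncomputable def condExp (p : ℕ → ℝ≥0∞) (n : ℕ) (f : PlaneTree → ℝ≥0∞) : ℝ≥0∞ :=
  (∑' t : PlaneTree, if PlaneTree.size t = n then gwProb p t * f t else 0) / probSize p n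

/-- The variance of the offspring distribution `p` (which has mean `1`). -/
noncomputable def xiVar (p : ℕ → ℝ≥0∞) : ℝ≥0∞ :=
  ∑' k : ℕ, p k * ENNReal.ofReal (((k : ℝ) - 1) ^ 2)

/-- `P_k(t)`: the number of unordered pairs of vertices of `t` at graph distance `k`. -/
noncomputable def pairCount (t : PlaneTree) (k : ℕ) : ℕ :=
  {s : Set (List ℕ) | ∃ v w, v ∈ PlaneTree.vertexSet t ∧ w ∈ PlaneTree.vertexSet t ∧
    s = {v, w} ∧ treeDist v w = k}.ncard

/-- The number of unordered pairs of vertices of `t` at graph distance `k` from each other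
whose last common ancestor is the vertex at position `u` (equivalently, the pairs of
vertices of the subtree rooted at `u` whose connecting path passes through `u`; one of the
two vertices may be `u` itself). -/
noncomputable def pairCountThrough (t : PlaneTree) (u : List ℕ) (k : ℕ) : ℕ :=
  {s : Set (List ℕ) | ∃ v w, v ∈ PlaneTree.vertexSet t ∧ w ∈ PlaneTree.vertexSet t ∧
    s = {v, w} ∧ treeDist v w = k ∧ lca v w = u}.ncard

/-- `Q_k(t)`: the number of unordered pairs of vertices of `t` at graph distance `k`
whose connecting path passes through the root of `t`. -/
noncomputable def rootPairCount (t : PlaneTree) (k : ℕ) : ℕ := pairCountThrough t [] k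

section Series
open PowerSeries

theorem coeff_mul_mk_tsum (G : PowerSeries ℝ≥0∞) (A : ℕ → PowerSeries ℝ≥0∞) (n : ℕ) :
    coeff n (G * mk fun i => ∑' k, coeff i (A k)) = ∑' k, coeff n (G * A k) := by
  simp only [coeff_mul, coeff_mk]
  rw [Summable.tsum_finsetSum fun _ _ => ENNReal.summable]
  exact Finset.sum_congr rfl fun _ _ => ENNReal.tsum_mul_left.symm

/-- The composition `∑ₖ cₖ F^(eₖ)` of power series with extended nonnegative coefficients. -/
noncomputable def powSum (F : PowerSeries ℝ≥0∞) (c : ℕ → ℝ≥0∞) (e : ℕ → ℕ) : PowerSeries ℝ≥0∞ :=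
  mk fun n => ∑' k, c k * coeff n (F ^ e k)

theorem coeff_mul_powSum (F G : PowerSeries ℝ≥0∞) (c : ℕ → ℝ≥0∞) (e : ℕ → ℕ) (n : ℕ) :
    coeff n (G * powSum F c e) = ∑' k, c k * coeff n (G * F ^ e k) := by
  have h := coeff_mul_mk_tsum G (fun k => C (c k) * F ^ e k) n
  simp only [mul_left_comm G, coeff_C_mul] at h
  exact h

/-- Multiplication by a composed series preserves geometric bounds on the coefficients. -/
theorem coeff_pow_mul_powSum_le {F G : PowerSeries ℝ≥0∞} {N : ℕ} {B x : ℝ≥0∞}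
    (h : ∀ m, coeff N (F ^ m * G) ≤ B * x ^ m) (c : ℕ → ℝ≥0∞) (e : ℕ → ℕ) (m : ℕ) :
    coeff N (F ^ m * (powSum F c e * G)) ≤ (B * ∑' k, c k * x ^ e k) * x ^ m := by
  have hr : F ^ m * (powSum F c e * G) = (F ^ m * G) * powSum F c e := by ring
  rw [hr, coeff_mul_powSum, ← ENNReal.tsum_mul_left, ← ENNReal.tsum_mul_right]
  refine ENNReal.tsum_le_tsum fun k => ?_
  have hr' : F ^ m * G * F ^ e k = F ^ (m + e k) * G := by ring
  rw [hr']
  calc c k * coeff N (F ^ (m + e k) * G) ≤ c k * (B * x ^ (m + e k)) := by gcongr; exact h _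
    _ = _ := by ring

theorem coeff_pow_mul_powSum_pow_le {F G : PowerSeries ℝ≥0∞} {N : ℕ} {B x : ℝ≥0∞}
    (h : ∀ m, coeff N (F ^ m * G) ≤ B * x ^ m) (c : ℕ → ℝ≥0∞) (e : ℕ → ℕ) (l m : ℕ) :
    coeff N (F ^ m * (powSum F c e ^ l * G)) ≤ (B * (∑' k, c k * x ^ e k) ^ l) * x ^ m := by
  induction l generalizing m with
  | zero => simpa using h m
  | succ l ih =>
    have := coeff_pow_mul_powSum_le ih c e m
    rw [pow_succ', mul_assoc, pow_succ, ← mul_assoc B]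
    exact this

section Lagrange
variable {p : ℕ → ℝ≥0∞} {F : PowerSeries ℝ≥0∞}

theorem coeff_pow_succ_of_fixed (hF : F = X * powSum F p id) (m n : ℕ) :
    coeff (n + 1) (F ^ (m + 1)) = ∑' k, p k * coeff n (F ^ (m + k)) := by
  have : F ^ (m + 1) = X * (F ^ m * powSum F p id) := by
    rw [pow_succ]; nth_rw 2 [hF]; ring
  rw [this, coeff_succ_X_mul, coeff_mul_powSum]
  simp [pow_add]

theorem coeff_pow_eq_zero_of_fixed (hF : F = X * powSum F p id) {m n : ℕ} (h : n < m) :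
    coeff n (F ^ m) = 0 := by
  rw [hF, mul_pow, coeff_X_pow_mul', if_neg (by omega)]

theorem coeff_mul_eq_sum_range {R : Type*} [Semiring R] (G Φ : PowerSeries R) (j : ℕ) :
    coeff j (G * Φ) = ∑ k ∈ Finset.range (j + 1), coeff k G * coeff (j - k) Φ := by
  rw [coeff_mul, Finset.Nat.sum_antidiagonal_eq_sum_range_succ_mk]

theorem coeff_X_mul_derivative {R : Type*} [CommSemiring R] (A : PowerSeries R) (k : ℕ) :
    coeff k (X * derivative R A) = k * coeff k A := by
  cases k with
  | zero => simp
  | succ k => rw [coeff_succ_X_mul, coeff_derivative]; push_cast; ring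

theorem succ_mul_coeff_mul_pow {R : Type*} [CommSemiring R] (Φ : PowerSeries R) (N j : ℕ) :
    ((N : R) + 1) * coeff j (X * derivative R Φ * Φ ^ N) = j * coeff j (Φ ^ (N + 1)) := by
  rw [← coeff_X_mul_derivative, derivative_pow]
  have : X * ((((N + 1 : ℕ) : PowerSeries R)) * Φ ^ (N + 1 - 1) * derivative R Φ)
      = C ((N : R) + 1) * (X * derivative R Φ * Φ ^ N) := by
    simp; ring
  rw [this, coeff_C_mul]

/-- The Otter–Dwass formula. -/
theorem natCast_mul_coeff_pow_of_fixed (hF : F = X * powSum F p id) {m N : ℕ} (h : m ≤ N) :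
    (N : ℝ≥0∞) * coeff N (F ^ m) = m * coeff (N - m) (mk p ^ N) := by
  induction N generalizing m with
  | zero => obtain rfl : m = 0 := by omega
            simp
  | succ N ih =>
    cases m with
    | zero => simp [coeff_one]
    | succ m =>
      have hmN : m ≤ N := by omega
      rw [coeff_pow_succ_of_fixed hF, show N + 1 - (m + 1) = N - m by omega]
      have hfin : ∑' k, p k * coeff N (F ^ (m + k))
          = ∑ k ∈ Finset.range (N - m + 1), p k * coeff N (F ^ (m + k)) := by
        refine tsum_eq_sum fun k hk => ?_
        rw [coeff_pow_eq_zero_of_fixed hF, mul_zero]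
        simp at hk; omega
      rw [hfin]
      rcases Nat.eq_zero_or_pos N with rfl | hN
      · obtain rfl : m = 0 := by omega
        simp
      set j := N - m with hj
      have h1 : (N : ℝ≥0∞) * ∑ k ∈ Finset.range (j + 1), p k * coeff N (F ^ (m + k))
          = m * coeff j (mk p ^ (N + 1)) +
            coeff j (X * derivative ℝ≥0∞ (mk p) * mk p ^ N) := by
        rw [pow_succ', coeff_mul_eq_sum_range, coeff_mul_eq_sum_range, Finset.mul_sum,
          Finset.mul_sum, ← Finset.sum_add_distrib]
        refine Finset.sum_congr rfl fun k hk => ?_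
        simp only [Finset.mem_range] at hk
        have := ih (m := m + k) (by omega)
        rw [mul_left_comm, this, show N - (m + k) = j - k by omega]
        simp only [coeff_mk, coeff_X_mul_derivative]; push_cast; ring
      have h2 := succ_mul_coeff_mul_pow (mk p) N j
      have hN0 : (N : ℝ≥0∞) ≠ 0 := by simp; omega
      refine (ENNReal.mul_right_inj hN0 (ENNReal.natCast_ne_top N)).1 ?_
      push_cast
      rw [mul_left_comm, h1, mul_add, h2, ← mul_assoc, ← add_mul, ← mul_assoc]
      congr 1
      have hjN : N = j + m := by omega
      have : (N : ℝ≥0∞) = j + m := by rw [hjN]; push_cast; rfl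
      rw [this]; ring

end Lagrange
end Series

section Fourier
open PowerSeries

/-- A power series whose coefficients are absolutely summable. -/
def AbsSummable (A : PowerSeries ℝ) : Prop := Summable fun j => |coeff j A|

/-- The value at `exp (iθ)` of the function represented by a power series. -/
noncomputable def circleEval (A : PowerSeries ℝ) (θ : ℝ) : ℂ :=
  ∑' j, ((coeff j A : ℝ) : ℂ) * Complex.exp (Complex.I * θ) ^ j

theorem norm_exp_I_mul (θ : ℝ) : ‖Complex.exp (Complex.I * θ)‖ = 1 := by
  rw [mul_comm]; exact Complex.norm_exp_ofReal_mul_I θ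

theorem norm_coeff_mul_exp (A : PowerSeries ℝ) (θ : ℝ) (j : ℕ) :
    ‖((coeff j A : ℝ) : ℂ) * Complex.exp (Complex.I * θ) ^ j‖ = |coeff j A| := by
  rw [norm_mul, norm_pow, norm_exp_I_mul, one_pow, mul_one, Complex.norm_real, Real.norm_eq_abs]

theorem AbsSummable.norm {A : PowerSeries ℝ} (hA : AbsSummable A) (θ : ℝ) :
    Summable fun j => ‖((coeff j A : ℝ) : ℂ) * Complex.exp (Complex.I * θ) ^ j‖ := by
  simp only [norm_coeff_mul_exp]
  exact hA

theorem AbsSummable.mul {A B : PowerSeries ℝ} (hA : AbsSummable A) (hB : AbsSummable B) :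
    AbsSummable (A * B) := by
  have := summable_norm_sum_mul_antidiagonal_of_summable_norm (f := fun j => coeff j A)
    (g := fun j => coeff j B) hA hB
  simpa only [AbsSummable, coeff_mul, Real.norm_eq_abs] using this

theorem AbsSummable.one : AbsSummable 1 := by
  refine summable_of_ne_finset_zero (s := {0}) fun j hj => ?_
  simp_all [coeff_one]

theorem AbsSummable.pow {A : PowerSeries ℝ} (hA : AbsSummable A) (n : ℕ) :
    AbsSummable (A ^ n) := by
  induction n with
  | zero => simpa using AbsSummable.one
  | succ n ih => rw [pow_succ]; exact ih.mul hA

theorem circleEval_mul {A B : PowerSeries ℝ} (hA : AbsSummable A) (hB : AbsSummable B) (θ : ℝ) :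
    circleEval (A * B) θ = circleEval A θ * circleEval B θ := by
  unfold circleEval
  rw [tsum_mul_tsum_eq_tsum_sum_antidiagonal_of_summable_norm (hA.norm θ) (hB.norm θ)]
  refine tsum_congr fun n => ?_
  rw [coeff_mul, Complex.ofReal_sum, Finset.sum_mul]
  refine Finset.sum_congr rfl fun x hx => ?_
  rw [← Finset.HasAntidiagonal.mem_antidiagonal.1 hx, pow_add]
  push_cast; ring

theorem circleEval_one (θ : ℝ) : circleEval 1 θ = 1 := by
  unfold circleEval
  rw [tsum_eq_single 0 (fun j hj => by simp [coeff_one, hj])]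
  simp

theorem circleEval_pow {A : PowerSeries ℝ} (hA : AbsSummable A) (n : ℕ) (θ : ℝ) :
    circleEval (A ^ n) θ = circleEval A θ ^ n := by
  induction n with
  | zero => simpa using circleEval_one θ
  | succ n ih => rw [pow_succ, pow_succ, circleEval_mul (hA.pow n) hA, ih]

theorem continuous_circleEval {A : PowerSeries ℝ} (hA : AbsSummable A) :
    Continuous (circleEval A) := by
  refine continuous_tsum (fun j => by fun_prop) hA fun j θ => (norm_coeff_mul_exp A θ j).le

theorem integral_exp_I_mul_int {d : ℕ} (hd : 0 < d) {l : ℤ} (hl : (d : ℤ) ∣ l) :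
    ∫ θ in -(Real.pi / d)..(Real.pi / d), Complex.exp (Complex.I * l * (θ : ℂ))
      = if l = 0 then (2 * Real.pi / d : ℂ) else 0 := by
  split_ifs with h
  · subst h
    simp
    ring
  · have hl' : (l : ℂ) ≠ 0 := by exact_mod_cast h
    rw [integral_exp_mul_complex (mul_ne_zero Complex.I_ne_zero hl')]
    obtain ⟨s, rfl⟩ := hl
    have hdc : (d : ℂ) ≠ 0 := by exact_mod_cast hd.ne'
    have : Complex.I * ((d * s : ℤ) : ℂ) * ((Real.pi / d : ℝ) : ℂ)
        = Complex.I * ((d * s : ℤ) : ℂ) * ((-(Real.pi / d) : ℝ) : ℂ)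
          + s * (2 * Real.pi * Complex.I) := by
      push_cast; field_simp; ring
    rw [this, Complex.exp_periodic.int_mul s, sub_self, zero_div]

/-- Fourier inversion on a reduced period, for series supported on multiples of `d`. -/
theorem integral_circleEval_mul_exp {A : PowerSeries ℝ} (hA : AbsSummable A) {d : ℕ} (hd : 0 < d)
    (hsupp : ∀ j, coeff j A ≠ 0 → d ∣ j) {j : ℕ} (hj : d ∣ j) :
    ∫ θ in -(Real.pi / d)..(Real.pi / d), circleEval A θ * Complex.exp (-(Complex.I * j * θ))
      = 2 * Real.pi / d * coeff j A := by
  have hs := intervalIntegral.hasSum_integral_of_dominated_convergence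
    (μ := MeasureTheory.volume) (a := -(Real.pi / d)) (b := Real.pi / d)
    (F := fun i (θ : ℝ) => ((coeff i A : ℝ) : ℂ) * Complex.exp (Complex.I * θ) ^ i
      * Complex.exp (-(Complex.I * j * θ)))
    (f := fun θ => circleEval A θ * Complex.exp (-(Complex.I * j * θ)))
    (fun i _ => |coeff i A|) (fun i => Continuous.aestronglyMeasurable (by fun_prop))
    (fun i => Eventually.of_forall fun θ _ => ?_) (Eventually.of_forall fun θ _ => hA)
    (by simp) (Eventually.of_forall fun θ _ => ?_)
  · refine hs.unique ?_
    have hterm : ∀ i : ℕ, ∫ θ in -(Real.pi / d)..(Real.pi / d),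
        ((coeff i A : ℝ) : ℂ) * Complex.exp (Complex.I * θ) ^ i * Complex.exp (-(Complex.I * j * θ))
        = if i = j then (2 * Real.pi / d * (coeff j A : ℝ) : ℂ) else 0 := by
      intro i
      have hcongr : ∀ θ : ℝ, ((coeff i A : ℝ) : ℂ) * Complex.exp (Complex.I * θ) ^ i
          * Complex.exp (-(Complex.I * j * θ))
          = (coeff i A : ℝ) * Complex.exp (Complex.I * ((i - j : ℤ) : ℂ) * θ) := by
        intro θ
        rw [mul_assoc, ← Complex.exp_nat_mul, ← Complex.exp_add]
        congr 2; push_cast; ring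
      simp_rw [hcongr]
      rw [intervalIntegral.integral_const_mul]
      by_cases hc : coeff i A = 0
      · by_cases hij : i = j
        · subst hij; simp [hc]
        · simp [hc, hij]
      · have hdvd : (d : ℤ) ∣ (i - j : ℤ) :=
          dvd_sub (by exact_mod_cast hsupp i hc) (by exact_mod_cast hj)
        rw [integral_exp_I_mul_int hd hdvd]
        by_cases hij : i = j
        · subst hij; simp; ring
        · rw [if_neg (by omega), if_neg hij, mul_zero]
    simp_rw [hterm]
    convert hasSum_ite_eq j (2 * Real.pi / d * (coeff j A : ℝ) : ℂ)
  · rw [norm_mul, norm_coeff_mul_exp]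
    have : -(Complex.I * j * θ) = ((-(j * θ) : ℝ) : ℂ) * Complex.I := by push_cast; ring
    rw [this, Complex.norm_exp_ofReal_mul_I, mul_one]
  · exact (hA.norm θ).of_norm.hasSum.mul_right _

theorem dvd_of_coeff_pow_ne_zero {A : PowerSeries ℝ} {d : ℕ}
    (hsupp : ∀ j, coeff j A ≠ 0 → d ∣ j) (n j : ℕ) (h : coeff j (A ^ n) ≠ 0) : d ∣ j := by
  induction n generalizing j with
  | zero =>
    by_contra hj
    have : j ≠ 0 := fun h0 => hj (h0 ▸ dvd_zero d)
    simp [coeff_one, this] at h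
  | succ n ih =>
    rw [pow_succ, coeff_mul] at h
    obtain ⟨x, hx, hne⟩ := Finset.exists_ne_zero_of_sum_ne_zero h
    rw [← Finset.HasAntidiagonal.mem_antidiagonal.1 hx]
    exact dvd_add (ih _ (left_ne_zero_of_mul hne)) (hsupp _ (right_ne_zero_of_mul hne))

end Fourier

section Decay
open PowerSeries

theorem norm_add_mul_exp_le {a b : ℝ} (ha : 0 < a) (hb : 0 < b) (x : ℝ) :
    ‖(a : ℂ) + b * Complex.exp (Complex.I * x)‖
      ≤ a + b - a * b / (a + b) * (1 - Real.cos x) := by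
  set w : ℝ := ‖(a : ℂ) + b * Complex.exp (Complex.I * x)‖ with hw
  have hsq : w ^ 2 = (a + b) ^ 2 - 2 * (a * b) * (1 - Real.cos x) := by
    rw [hw, ← Complex.normSq_eq_norm_sq, mul_comm Complex.I, Complex.exp_mul_I, ← Complex.ofReal_cos,
      ← Complex.ofReal_sin, Complex.normSq_apply]
    simp [-Complex.ofReal_cos, -Complex.ofReal_sin]
    linear_combination b ^ 2 * Real.sin_sq_add_cos_sq x
  have hcos := Real.cos_le_one x
  have hcos' := Real.neg_one_le_cos x
  have hs : a * b / (a + b) * (a + b) = a * b := by field_simp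
  set c := a * b / (a + b) with hc
  have hc0 : 0 < c := by positivity
  refine abs_le_of_sq_le_sq' ?_ ?_ |>.2
  · rw [hsq]
    nlinarith [sq_nonneg (c * (1 - Real.cos x))]
  · have : 4 * (a * b) ≤ (a + b) ^ 2 := by nlinarith [sq_nonneg (a - b)]
    have : 4 * c ≤ a + b := by
      have h0 : 0 < a + b := by positivity
      nlinarith
    nlinarith

theorem one_sub_cos_add_le (x y : ℝ) :
    1 - Real.cos (x + y) ≤ 2 * (1 - Real.cos x) + 2 * (1 - Real.cos y) := by
  rw [Real.cos_add]
  nlinarith [Real.sin_sq_add_cos_sq x, Real.sin_sq_add_cos_sq y, sq_nonneg (Real.sin x - Real.sin y),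
    sq_nonneg (Real.cos x + Real.cos y - 2), Real.cos_le_one x, Real.cos_le_one y,
    sq_nonneg (Real.sin x + Real.sin y), sq_nonneg (Real.cos x - Real.cos y)]

variable {q : ℕ → ℝ}

theorem absSummable_mk (hq : ∀ k, 0 ≤ q k) (hsum : HasSum q 1) : AbsSummable (mk q) := by
  simpa [AbsSummable, abs_of_nonneg (hq _)] using hsum.summable

theorem norm_circleEval_le (hq : ∀ k, 0 ≤ q k) (hsum : HasSum q 1) {k : ℕ} (hk : k ≠ 0) (θ : ℝ) :
    ‖circleEval (mk q) θ‖ ≤ ‖(q 0 : ℂ) + q k * Complex.exp (Complex.I * ((k * θ : ℝ) : ℂ))‖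
      + (1 - q 0 - q k) := by
  have hs := ((absSummable_mk hq hsum).norm θ).of_norm
  have h0k : (0 : ℕ) ∉ ({k} : Finset ℕ) := by simp [hk.symm]
  have hsplit := hs.sum_add_tsum_subtype_compl ({0, k} : Finset ℕ)
  have hsplit' := hsum.summable.sum_add_tsum_subtype_compl ({0, k} : Finset ℕ)
  rw [Finset.sum_insert h0k, Finset.sum_singleton] at hsplit hsplit'
  rw [hsum.tsum_eq] at hsplit'
  unfold circleEval
  rw [← hsplit]
  refine (norm_add_le _ _).trans (add_le_add (le_of_eq ?_) ?_)
  · congr 1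
    rw [← Complex.exp_nat_mul, ← Complex.exp_nat_mul]
    simp only [coeff_mk, Nat.cast_zero, zero_mul, Complex.exp_zero, mul_one]
    congr 3
    push_cast; ring
  · have h1 : 1 - q 0 - q k = ∑' x : { x // x ∉ ({0, k} : Finset ℕ) }, q x := by linarith
    rw [h1]
    have hterm : ∀ x : { x // x ∉ ({0, k} : Finset ℕ) },
        ‖((coeff (x : ℕ) (mk q) : ℝ) : ℂ) * Complex.exp (Complex.I * θ) ^ (x : ℕ)‖ = q x := by
      intro x; rw [norm_coeff_mul_exp, coeff_mk, abs_of_nonneg (hq _)]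
    refine (norm_tsum_le_tsum_norm ?_).trans (le_of_eq ?_)
    · simp_rw [hterm]; exact hsum.summable.subtype _
    · simp_rw [hterm]

theorem norm_circleEval_le_one (hq : ∀ k, 0 ≤ q k) (hsum : HasSum q 1) (θ : ℝ) :
    ‖circleEval (mk q) θ‖ ≤ 1 := by
  refine (norm_tsum_le_tsum_norm ((absSummable_mk hq hsum).norm θ)).trans ?_
  simp_rw [norm_coeff_mul_exp, coeff_mk, abs_of_nonneg (hq _)]
  exact hsum.tsum_eq.le

/-- The frequencies `k` for which `1 - |φ(θ)|` dominates `1 - cos (kθ)`. -/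
noncomputable def dominatedFrequencies (hq : ∀ k, 0 ≤ q k) (hsum : HasSum q 1) : AddSubgroup ℤ where
  carrier := {k | ∃ c > 0, ∀ θ : ℝ, c * (1 - Real.cos (k * θ)) ≤ 1 - ‖circleEval (mk q) θ‖}
  zero_mem' := ⟨1, one_pos, fun θ => by simpa using norm_circleEval_le_one hq hsum θ⟩
  neg_mem' := by
    rintro k ⟨c, hc, h⟩
    exact ⟨c, hc, fun θ => by simpa using h θ⟩
  add_mem' := by
    rintro k l ⟨c, hc, h⟩ ⟨c', hc', h'⟩
    refine ⟨min c c' / 4, by positivity, fun θ => ?_⟩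
    have h1 := one_sub_cos_add_le (k * θ) (l * θ)
    have h2 : min c c' * (1 - Real.cos (k * θ)) ≤ 1 - ‖circleEval (mk q) θ‖ :=
      (mul_le_mul_of_nonneg_right (min_le_left _ _) (by linarith [Real.cos_le_one (k * θ)])).trans
        (h θ)
    have h3 : min c c' * (1 - Real.cos (l * θ)) ≤ 1 - ‖circleEval (mk q) θ‖ :=
      (mul_le_mul_of_nonneg_right (min_le_right _ _) (by linarith [Real.cos_le_one (l * θ)])).trans
        (h' θ)
    have h4 : 0 < min c c' := by positivity
    push_cast
    rw [add_mul]
    nlinarith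

/-- The span `d` of a distribution charging `0`, with the Gaussian decay of its characteristic
function on `[-π/d, π/d]`. -/
theorem exists_span_decay (hq : ∀ k, 0 ≤ q k) (hsum : HasSum q 1) (hq0 : 0 < q 0)
    {K : ℕ} (hK : K ≠ 0) (hqK : 0 < q K) :
    ∃ d : ℕ, 0 < d ∧ (∀ k, q k ≠ 0 → d ∣ k) ∧ ∃ c > 0, ∀ θ : ℝ, |θ| ≤ Real.pi / d →
      ‖circleEval (mk q) θ‖ ≤ Real.exp (-c * θ ^ 2) := by
  obtain ⟨a, ha⟩ := Int.subgroup_cyclic (AddSubgroup.closure {k : ℤ | ∃ j : ℕ, q j ≠ 0 ∧ k = j})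
  have hmem : ∀ j : ℕ, q j ≠ 0 → a.natAbs ∣ j := by
    intro j hj
    have : (j : ℤ) ∈ AddSubgroup.closure {a} := by
      rw [← ha]; exact AddSubgroup.subset_closure ⟨j, hj, rfl⟩
    obtain ⟨s, hs⟩ := AddSubgroup.mem_closure_singleton.1 this
    have : a ∣ (j : ℤ) := ⟨s, by rw [← hs]; simp [mul_comm]⟩
    exact Int.natAbs_dvd_natAbs.2 this
  have hle : AddSubgroup.closure {k : ℤ | ∃ j : ℕ, q j ≠ 0 ∧ k = j}
      ≤ dominatedFrequencies hq hsum := by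
    rw [AddSubgroup.closure_le]
    rintro _ ⟨j, hj, rfl⟩
    rcases eq_or_ne j 0 with rfl | hj0
    · exact (dominatedFrequencies hq hsum).zero_mem
    · have hjp : 0 < q j := lt_of_le_of_ne (hq j) hj.symm
      refine ⟨q 0 * q j / (q 0 + q j), by positivity, fun θ => ?_⟩
      have h1 := norm_circleEval_le hq hsum hj0 θ
      have h2 := norm_add_mul_exp_le hq0 hjp (j * θ)
      push_cast at h1 h2 ⊢
      linarith
  have had : (a.natAbs : ℤ) ∈ dominatedFrequencies hq hsum := by
    refine hle ?_
    rw [ha, AddSubgroup.mem_closure_singleton]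
    rcases Int.natAbs_eq a with h | h
    · exact ⟨1, by rw [one_smul]; exact h⟩
    · exact ⟨-1, by rw [neg_smul, one_smul]; omega⟩
  have hd : 0 < a.natAbs :=
    Nat.pos_of_ne_zero fun h => hK (Nat.eq_zero_of_zero_dvd (h ▸ hmem K hqK.ne'))
  refine ⟨a.natAbs, hd, hmem, ?_⟩
  obtain ⟨c, hc, h⟩ := had
  generalize a.natAbs = d at *
  have hdr : (0 : ℝ) < d := by exact_mod_cast hd
  refine ⟨c * (2 / Real.pi ^ 2 * d ^ 2), by positivity, fun θ hθ => ?_⟩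
  have hdθ : |(d : ℝ) * θ| ≤ Real.pi := by
    rw [abs_mul, abs_of_pos hdr]
    calc (d : ℝ) * |θ| ≤ d * (Real.pi / d) := by gcongr
      _ = Real.pi := by field_simp
  have h1 := Real.cos_le_one_sub_mul_cos_sq hdθ
  have h2 := h θ
  push_cast at h2
  have h3 : c * (2 / Real.pi ^ 2 * d ^ 2) * θ ^ 2 ≤ c * (1 - Real.cos (d * θ)) := by
    calc _ = c * (2 / Real.pi ^ 2 * (d * θ) ^ 2) := by ring
      _ ≤ _ := by gcongr; linarith
  have h4 := Real.add_one_le_exp (-(c * (2 / Real.pi ^ 2 * d ^ 2)) * θ ^ 2)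
  linarith

end Decay

section LocalUpperBound
open PowerSeries
variable {q : ℕ → ℝ}

theorem hasSum_one_sub_mul (hsum : HasSum q 1) (hmean : HasSum (fun k : ℕ => k * q k) 1) :
    HasSum (fun k : ℕ => (1 - (k : ℝ)) * q k) 0 := by
  have := hsum.sub hmean
  simp only [sub_self] at this
  exact this.congr_fun fun k => by ring

theorem absSummable_mk_one_sub_mul (hq : ∀ k, 0 ≤ q k) (hsum : HasSum q 1)
    (hmean : HasSum (fun k : ℕ => k * q k) 1) :
    AbsSummable (mk fun k => (1 - (k : ℝ)) * q k) := by
  refine Summable.of_nonneg_of_le (fun _ => abs_nonneg _) (fun k => ?_)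
    (hsum.summable.add hmean.summable)
  have := hq k
  rw [coeff_mk, abs_mul, abs_of_nonneg this]
  calc |1 - (k : ℝ)| * q k ≤ (|1| + |(k : ℝ)|) * q k := by gcongr; exact abs_sub _ _
    _ = q k + k * q k := by simp; ring

theorem norm_circleEval_centered_le (hq : ∀ k, 0 ≤ q k) (hsum : HasSum q 1)
    (hmean : HasSum (fun k : ℕ => k * q k) 1) {V : ℝ}
    (hV : HasSum (fun k : ℕ => ((k : ℝ) - 1) ^ 2 * q k) V) (θ : ℝ) :
    ‖circleEval (mk fun k => (1 - (k : ℝ)) * q k) θ‖ ≤ V * |θ| := by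
  set w := Complex.exp (Complex.I * θ) with hw
  have h0 : HasSum (fun k : ℕ => (((1 - (k : ℝ)) * q k : ℝ) : ℂ) * w) 0 := by
    have := (Complex.hasSum_ofReal.2 (hasSum_one_sub_mul hsum hmean)).mul_right w
    simpa using this
  have h1 := ((absSummable_mk_one_sub_mul hq hsum hmean).norm θ).of_norm.hasSum.sub h0
  rw [sub_zero] at h1
  unfold circleEval
  rw [← h1.tsum_eq]
  refine tsum_of_norm_bounded (hV.mul_right |θ|) fun k => ?_
  have hexp : w ^ k - w = w * (Complex.exp (Complex.I * (((k - 1) * θ : ℝ) : ℂ)) - 1) := by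
    rw [mul_sub, mul_one, hw, ← Complex.exp_nat_mul, ← Complex.exp_add]
    congr 2; push_cast; ring
  rw [coeff_mk, ← mul_sub, hexp, norm_mul, norm_mul, norm_exp_I_mul, one_mul, Complex.norm_real,
    norm_mul, Real.norm_eq_abs, Real.norm_eq_abs, abs_of_nonneg (hq k), abs_sub_comm]
  calc |(k : ℝ) - 1| * q k * ‖Complex.exp (Complex.I * (((k - 1) * θ : ℝ) : ℂ)) - 1‖
      ≤ |(k : ℝ) - 1| * q k * |(k - 1) * θ| := by
        gcongr
        · exact mul_nonneg (abs_nonneg _) (hq k)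
        · exact Real.norm_exp_I_mul_ofReal_sub_one_le
    _ = |(k : ℝ) - 1| ^ 2 * q k * |θ| := by rw [abs_mul]; ring
    _ = _ := by rw [sq_abs]

theorem abs_mul_exp_neg_mul_sq_le {a : ℝ} (ha : 0 < a) (x : ℝ) :
    |x| * Real.exp (-a * x ^ 2) ≤ (√a)⁻¹ * Real.exp (-(a / 2) * x ^ 2) := by
  have hs : 0 < √a := Real.sqrt_pos.2 ha
  have h1 : √a * |x| ≤ Real.exp (a / 2 * x ^ 2) := by
    have h2 := Real.add_one_le_exp (a / 2 * x ^ 2)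
    have h3 : a * x ^ 2 = (√a * |x|) ^ 2 := by rw [mul_pow, Real.sq_sqrt ha.le, sq_abs]
    nlinarith [sq_nonneg (√a * |x| - 1)]
  rw [inv_mul_eq_div, le_div_iff₀ hs]
  calc |x| * Real.exp (-a * x ^ 2) * √a = √a * |x| * Real.exp (-a * x ^ 2) := by ring
    _ ≤ Real.exp (a / 2 * x ^ 2) * Real.exp (-a * x ^ 2) := by gcongr
    _ = _ := by rw [← Real.exp_add]; congr 1; ring

theorem norm_intervalIntegral_le_of_le_gaussian {f : ℝ → ℂ} {A B a : ℝ} (ha : 0 < a) (hA : 0 ≤ A)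
    (hB : 0 ≤ B) (hf : ∀ x, |x| ≤ A → ‖f x‖ ≤ B * (|x| * Real.exp (-a * x ^ 2))) :
    ‖∫ x in -A..A, f x‖ ≤ B * √(2 * Real.pi) / a := by
  have hintegral : MeasureTheory.Integrable fun x : ℝ => B * ((√a)⁻¹ * Real.exp (-(a / 2) * x ^ 2)) :=
    ((integrable_exp_neg_mul_sq (half_pos ha)).const_mul _).const_mul _
  have hle : -A ≤ A := by linarith
  calc ‖∫ x in -A..A, f x‖ ≤ ∫ x in -A..A, B * ((√a)⁻¹ * Real.exp (-(a / 2) * x ^ 2)) := by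
        refine intervalIntegral.norm_integral_le_of_norm_le hle
          (MeasureTheory.ae_of_all _ fun x hx => ?_) hintegral.intervalIntegrable
        refine (hf x (abs_le.2 ⟨hx.1.le, hx.2⟩)).trans ?_
        exact mul_le_mul_of_nonneg_left (abs_mul_exp_neg_mul_sq_le ha x) hB
    _ ≤ ∫ x : ℝ, B * ((√a)⁻¹ * Real.exp (-(a / 2) * x ^ 2)) := by
        rw [intervalIntegral.integral_of_le hle]
        exact MeasureTheory.setIntegral_le_integral hintegral
          (MeasureTheory.ae_of_all _ fun x => by positivity)
    _ = _ := by
        rw [MeasureTheory.integral_const_mul, MeasureTheory.integral_const_mul, integral_gaussian]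
        have : Real.pi / (a / 2) = 2 * Real.pi / a := by field_simp
        rw [this, Real.sqrt_div (by positivity)]
        have hs : √a * √a = a := Real.mul_self_sqrt ha.le
        have hs0 : √a ≠ 0 := (Real.sqrt_pos.2 ha).ne'
        have : (√a)⁻¹ * (√(2 * Real.pi) / √a) = √(2 * Real.pi) / (√a * √a) := by field_simp
        rw [this, hs]; ring

/-- Uniform bound on `(N - j) P(S_N = j)` for a random walk with mean step one. -/
theorem exists_sub_mul_coeff_pow_le (hq : ∀ k, 0 ≤ q k) (hsum : HasSum q 1)
    (hmean : HasSum (fun k : ℕ => k * q k) 1) {V : ℝ}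
    (hV : HasSum (fun k : ℕ => ((k : ℝ) - 1) ^ 2 * q k) V) (hV0 : 0 < V) (hq0 : 0 < q 0)
    {K : ℕ} (hK : K ≠ 0) (hqK : 0 < q K) :
    ∃ C > 0, ∀ N j : ℕ, 1 ≤ N → ((N : ℝ) - j) * coeff j (mk q ^ N) ≤ C := by
  obtain ⟨d, hd, hdvd, c, hc, hdecay⟩ := exists_span_decay hq hsum hq0 hK hqK
  have hA := absSummable_mk hq hsum
  have hG := absSummable_mk_one_sub_mul hq hsum hmean
  have hdr : (0 : ℝ) < d := by exact_mod_cast hd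
  set B := V * Real.exp (c * (Real.pi / d) ^ 2) with hB
  refine ⟨d / (2 * Real.pi) * (B * √(2 * Real.pi) / c), by positivity, ?_⟩
  rintro N j hN
  obtain ⟨M, rfl⟩ : ∃ M, N = M + 1 := ⟨N - 1, by omega⟩
  have hsupp : ∀ k, coeff k (mk q) ≠ 0 → d ∣ k := fun k hk => hdvd k (by simpa using hk)
  by_cases hj : d ∣ j
  swap
  · have : coeff j (mk q ^ (M + 1)) = 0 := by
      by_contra h
      exact hj (dvd_of_coeff_pow_ne_zero hsupp _ _ h)
    rw [this, mul_zero]; positivity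
  set G : PowerSeries ℝ := mk fun k => (1 - (k : ℝ)) * q k with hGdef
  have hGeq : G = mk q - X * derivative ℝ (mk q) := by
    ext k; rw [map_sub, coeff_X_mul_derivative, hGdef]; simp; ring
  have hcoeff : ((M + 1 : ℕ) - (j : ℝ)) * coeff j (mk q ^ (M + 1))
      = (M + 1) * coeff j (G * mk q ^ M) := by
    rw [hGeq, sub_mul (mk q), ← pow_succ', map_sub, mul_sub, succ_mul_coeff_mul_pow]
    push_cast; ring
  have hsuppG : ∀ k, coeff k (G * mk q ^ M) ≠ 0 → d ∣ k := by
    intro k hk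
    rw [coeff_mul] at hk
    obtain ⟨x, hx, hne⟩ := Finset.exists_ne_zero_of_sum_ne_zero hk
    rw [← Finset.HasAntidiagonal.mem_antidiagonal.1 hx]
    refine dvd_add (hdvd _ ?_) (dvd_of_coeff_pow_ne_zero hsupp _ _ (right_ne_zero_of_mul hne))
    have := left_ne_zero_of_mul hne
    rw [hGdef, coeff_mk] at this
    exact right_ne_zero_of_mul this
  have hinv := integral_circleEval_mul_exp (hG.mul (hA.pow M)) hd hsuppG hj
  have ha : 0 < c * (M + 1) := by positivity
  have hbound := norm_intervalIntegral_le_of_le_gaussian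
    (f := fun θ => circleEval (G * mk q ^ M) θ * Complex.exp (-(Complex.I * j * θ)))
    (A := Real.pi / d) (B := B) ha (by positivity) (by positivity) (fun θ hθ => by
      have hexp : -(Complex.I * j * θ) = ((-(j * θ) : ℝ) : ℂ) * Complex.I := by push_cast; ring
      rw [norm_mul, hexp, Complex.norm_exp_ofReal_mul_I, mul_one, circleEval_mul hG (hA.pow M),
        circleEval_pow hA, norm_mul, norm_pow]
      have h1 := norm_circleEval_centered_le hq hsum hmean hV θ
      have h2 := hdecay θ hθ
      have h3 : θ ^ 2 ≤ (Real.pi / d) ^ 2 := sq_le_sq' (abs_le.1 hθ).1 (abs_le.1 hθ).2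
      calc _ ≤ V * |θ| * Real.exp (-c * θ ^ 2) ^ M := by gcongr
        _ = V * |θ| * (Real.exp (c * θ ^ 2) * Real.exp (-(c * (M + 1)) * θ ^ 2)) := by
            rw [← Real.exp_nat_mul, ← Real.exp_add]; congr 2; ring
        _ ≤ V * |θ| * (Real.exp (c * (Real.pi / d) ^ 2) * Real.exp (-(c * (M + 1)) * θ ^ 2)) := by
            gcongr
        _ = _ := by rw [hB]; ring)
  rw [hinv] at hbound
  have hnorm : ‖(2 * Real.pi / d * (coeff j (G * mk q ^ M) : ℝ) : ℂ)‖
      = 2 * Real.pi / d * |coeff j (G * mk q ^ M)| := by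
    have : (2 * Real.pi / d * (coeff j (G * mk q ^ M) : ℝ) : ℂ)
        = ((2 * Real.pi / d * coeff j (G * mk q ^ M) : ℝ) : ℂ) := by push_cast; ring
    rw [this, Complex.norm_real, Real.norm_eq_abs, abs_mul, abs_of_pos (by positivity)]
  rw [hnorm] at hbound
  rw [hcoeff]
  have h1 : ((M : ℝ) + 1) * (2 * Real.pi / d * |coeff j (G * mk q ^ M)|)
      ≤ B * √(2 * Real.pi) / c := by
    calc _ ≤ ((M : ℝ) + 1) * (B * √(2 * Real.pi) / (c * (M + 1))) := by gcongr
      _ = _ := by field_simp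
  calc ((M : ℝ) + 1) * coeff j (G * mk q ^ M) ≤ (M + 1) * |coeff j (G * mk q ^ M)| := by
        gcongr; exact le_abs_self _
    _ = d / (2 * Real.pi) * ((M + 1) * (2 * Real.pi / d * |coeff j (G * mk q ^ M)|)) := by
        field_simp
    _ ≤ _ := by gcongr

end LocalUpperBound

section LocalLowerBound
open PowerSeries MeasureTheory
open scoped Topology
variable {q : ℕ → ℝ}

/-- The law on `ℕ` with the point masses `q`. -/
noncomputable def natLaw (q : ℕ → ℝ) : Measure ℕ :=
  Measure.sum fun k => ENNReal.ofReal (q k) • Measure.dirac k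

theorem natLaw_singleton (q : ℕ → ℝ) (k : ℕ) : natLaw q {k} = ENNReal.ofReal (q k) := by
  rw [natLaw, Measure.sum_apply _ (measurableSet_singleton k), tsum_eq_single k]
  · simp
  · intro b hb; simp [hb]

theorem integrable_natLaw {E : Type*} [NormedAddCommGroup E] (hq : ∀ k, 0 ≤ q k) {f : ℕ → E}
    (hf : Summable fun k => q k * ‖f k‖) : Integrable f (natLaw q) := by
  refine ⟨(StronglyMeasurable.of_discrete).aestronglyMeasurable, ?_⟩
  rw [hasFiniteIntegral_iff_enorm, lintegral_countable']
  have : ∀ k, ‖f k‖ₑ * natLaw q {k} = ENNReal.ofReal (q k * ‖f k‖) := by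
    intro k
    rw [natLaw_singleton, ENNReal.ofReal_mul (hq k), ofReal_norm, mul_comm]
  simp_rw [this]
  exact hf.tsum_ofReal_lt_top

theorem integral_natLaw {E : Type*} [NormedAddCommGroup E] [NormedSpace ℝ E] [CompleteSpace E]
    (hq : ∀ k, 0 ≤ q k) {f : ℕ → E} (hf : Summable fun k => q k * ‖f k‖) :
    ∫ k, f k ∂natLaw q = ∑' k, q k • f k := by
  rw [integral_countable (integrable_natLaw hq hf)]
  refine tsum_congr fun k => ?_
  rw [Measure.real, natLaw_singleton, ENNReal.toReal_ofReal (hq k)]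

theorem isProbabilityMeasure_natLaw (hq : ∀ k, 0 ≤ q k) (hsum : HasSum q 1) :
    IsProbabilityMeasure (natLaw q) := by
  refine ⟨?_⟩
  rw [natLaw, Measure.sum_apply _ MeasurableSet.univ]
  simp only [Measure.smul_apply, measure_univ, smul_eq_mul, mul_one]
  rw [← ENNReal.ofReal_tsum_of_nonneg hq hsum.summable, hsum.tsum_eq, ENNReal.ofReal_one]

theorem tendsto_circleEval_pow (hq : ∀ k, 0 ≤ q k) (hsum : HasSum q 1)
    (hmean : HasSum (fun k : ℕ => k * q k) 1) {V : ℝ}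
    (hV : HasSum (fun k : ℕ => ((k : ℝ) - 1) ^ 2 * q k) V) (hV0 : 0 < V) (t : ℝ) :
    Tendsto (fun n : ℕ => (circleEval (mk q) (t / √n) *
      Complex.exp (-(Complex.I * ((t / √n : ℝ) : ℂ)))) ^ n) atTop
      (𝓝 (Complex.exp (((-(V / 2) * t ^ 2 : ℝ) : ℂ)))) := by
  have := isProbabilityMeasure_natLaw hq hsum
  have hs : 0 < √V := Real.sqrt_pos.2 hV0
  set Y : ℕ → ℝ := fun k => ((k : ℝ) - 1) / √V with hY
  have hYm : Measurable Y := measurable_of_countable _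
  have hYsum : Summable fun k => q k * ‖Y k‖ := by
    have := (absSummable_mk_one_sub_mul hq hsum hmean).div_const √V
    refine this.congr fun k => ?_
    rw [hY, coeff_mk, abs_mul, Real.norm_eq_abs, abs_div, abs_of_nonneg (hq k), abs_of_pos hs,
      abs_sub_comm]
    ring
  have hY0 : ∫ k, Y k ∂natLaw q = 0 := by
    rw [integral_natLaw hq hYsum]
    have := ((hasSum_one_sub_mul hsum hmean).mul_right (-(√V)⁻¹)).tsum_eq
    rw [zero_mul] at this
    rw [← this]
    refine tsum_congr fun k => ?_
    rw [hY, smul_eq_mul]; field_simp; ring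
  have hY1 : ∫ k, (Y ^ 2) k ∂natLaw q = 1 := by
    have h2 : HasSum (fun k => q k * (Y ^ 2) k) 1 := by
      have := hV.div_const V
      rw [div_self hV0.ne'] at this
      refine this.congr_fun fun k => ?_
      rw [hY, Pi.pow_apply, div_pow, Real.sq_sqrt hV0.le]; ring
    rw [integral_natLaw hq]
    · exact h2.tsum_eq
    · refine h2.summable.congr fun k => ?_
      rw [Pi.pow_apply, Real.norm_of_nonneg (sq_nonneg _)]
  have hchar : ∀ s : ℝ, charFun ((natLaw q).map Y) (√V * s)
      = circleEval (mk q) s * Complex.exp (-(Complex.I * (s : ℂ))) := by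
    intro s
    rw [charFun_apply_real, integral_map hYm.aemeasurable (by fun_prop), integral_natLaw hq]
    · rw [circleEval, ← tsum_mul_right]
      refine tsum_congr fun k => ?_
      rw [coeff_mk, Complex.real_smul, ← Complex.exp_nat_mul, mul_assoc (q k : ℂ),
        ← Complex.exp_add]
      congr 2
      rw [hY]
      have : (√V : ℂ) ≠ 0 := by exact_mod_cast hs.ne'
      push_cast; field_simp; ring
    · refine hsum.summable.congr fun k => ?_
      rw [← Complex.ofReal_mul, Complex.norm_exp_ofReal_mul_I, mul_one]
  have key := ProbabilityTheory.tendsto_charFun_inv_sqrt_mul_pow hYm.aemeasurable hY0 hY1 (√V * t)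
  have hlim : Complex.exp (-((√V * t : ℝ) : ℂ) ^ 2 / 2)
      = Complex.exp ((-(V / 2) * t ^ 2 : ℝ) : ℂ) := by
    congr 1
    have : (√V : ℂ) ^ 2 = V := by exact_mod_cast Real.sq_sqrt hV0.le
    push_cast
    rw [mul_pow, this]; ring
  rw [hlim] at key
  refine key.congr fun n => ?_
  rw [← hchar]
  congr 2; ring

theorem coeff_pow_nonneg (hq : ∀ k, 0 ≤ q k) (n j : ℕ) : 0 ≤ coeff j (mk q ^ n) := by
  induction n generalizing j with
  | zero => rw [pow_zero, coeff_one]; split_ifs <;> norm_num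
  | succ n ih =>
    rw [pow_succ, coeff_mul]
    exact Finset.sum_nonneg fun x _ => mul_nonneg (ih _) (by rw [coeff_mk]; exact hq _)

theorem exists_forall_le_of_eventually {u : ℕ → ℝ} (hu : ∀ n, 0 ≤ u n) {c : ℝ} (hc : 0 < c)
    (h : ∀ᶠ n in atTop, u n ≠ 0 → c ≤ u n) : ∃ c' > 0, ∀ n, u n ≠ 0 → c' ≤ u n := by
  obtain ⟨N, hN⟩ := eventually_atTop.1 h
  clear h
  induction N generalizing c with
  | zero => exact ⟨c, hc, fun n => hN n (Nat.zero_le n)⟩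
  | succ N ih =>
    by_cases h0 : u N = 0
    · refine ih hc fun n hn hne => hN n ?_ hne
      rcases hn.eq_or_lt with rfl | hlt
      · exact absurd h0 hne
      · exact hlt
    · have hpos : 0 < u N := lt_of_le_of_ne (hu N) (Ne.symm h0)
      refine ih (lt_min hc hpos) fun n hn hne => ?_
      rcases hn.eq_or_lt with rfl | hlt
      · exact min_le_right _ _
      · exact (min_le_left _ _).trans (hN n hlt hne)

/-- The local limit lower bound `P(S_n = n - 1) ≥ c / √n`, whenever this probability is
positive. -/
theorem exists_le_coeff_pow (hq : ∀ k, 0 ≤ q k) (hsum : HasSum q 1)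
    (hmean : HasSum (fun k : ℕ => k * q k) 1) {V : ℝ}
    (hV : HasSum (fun k : ℕ => ((k : ℝ) - 1) ^ 2 * q k) V) (hV0 : 0 < V) (hq0 : 0 < q 0)
    {K : ℕ} (hK : K ≠ 0) (hqK : 0 < q K) :
    ∃ c > 0, ∀ n : ℕ, 1 ≤ n → coeff (n - 1) (mk q ^ n) ≠ 0 → c / √n ≤ coeff (n - 1) (mk q ^ n) := by
  obtain ⟨d, hd, hdvd, c, hc, hdecay⟩ := exists_span_decay hq hsum hq0 hK hqK
  have hA := absSummable_mk hq hsum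
  have hdr : (0 : ℝ) < d := by exact_mod_cast hd
  have hsupp : ∀ k, coeff k (mk q) ≠ 0 → d ∣ k := fun k hk => hdvd k (by simpa using hk)
  set g : ℝ → ℂ := fun θ => circleEval (mk q) θ * Complex.exp (-(Complex.I * (θ : ℂ))) with hg
  have hgc : Continuous g := (continuous_circleEval hA).mul (by fun_prop)
  have hexpn : ∀ x : ℝ, ‖Complex.exp (Complex.I * (x : ℂ))‖ = 1 := norm_exp_I_mul
  have hgn : ∀ θ, ‖g θ‖ = ‖circleEval (mk q) θ‖ := by
    intro θ
    have := hexpn (-θ)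
    rw [Complex.ofReal_neg, mul_neg] at this
    rw [hg, norm_mul, this, mul_one]
  set f : ℕ → ℝ → ℂ := fun n => (Icc (-(√n * (Real.pi / d))) (√n * (Real.pi / d))).indicator
    fun t => g (t / √n) ^ n * Complex.exp (Complex.I * ((t / √n : ℝ) : ℂ)) with hf
  have hlim : Tendsto (fun n => ∫ t, f n t) atTop
      (𝓝 (∫ t : ℝ, Complex.exp (((-(V / 2) * t ^ 2 : ℝ) : ℂ)))) := by
    refine tendsto_integral_of_dominated_convergence (fun t => Real.exp (-c * t ^ 2))
      (fun n => ?_) (integrable_exp_neg_mul_sq hc) (fun n => ae_of_all _ fun t => ?_)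
      (ae_of_all _ fun t => ?_)
    · refine (Continuous.aestronglyMeasurable ?_).indicator measurableSet_Icc
      exact ((hgc.comp (by fun_prop)).pow n).mul (by fun_prop)
    · by_cases ht : t ∈ Icc (-(√n * (Real.pi / d))) (√n * (Real.pi / d))
      · rw [hf]
        simp only [indicator_of_mem ht]
        rw [norm_mul, norm_pow, hgn, hexpn, mul_one]
        rcases Nat.eq_zero_or_pos n with rfl | hn
        · have : t = 0 := by simpa using ht
          simp [this]
        · have hsn : 0 < √(n : ℝ) := Real.sqrt_pos.2 (by exact_mod_cast hn)
          have hθ : |t / √n| ≤ Real.pi / d := by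
            rw [abs_div, abs_of_pos hsn, div_le_iff₀ hsn, mul_comm]
            exact abs_le.2 ht
          calc _ ≤ Real.exp (-c * (t / √n) ^ 2) ^ n := by gcongr; exact hdecay _ hθ
            _ = Real.exp (-c * t ^ 2) := by
              rw [← Real.exp_nat_mul, div_pow, Real.sq_sqrt (Nat.cast_nonneg n)]
              congr 1; field_simp
      · rw [hf]
        simp only [indicator_of_notMem ht, norm_zero]
        positivity
    · have hsq : Tendsto (fun n : ℕ => √(n : ℝ)) atTop atTop :=
        Real.tendsto_sqrt_atTop.comp tendsto_natCast_atTop_atTop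
      have hdiv : Tendsto (fun n : ℕ => t / √(n : ℝ)) atTop (𝓝 0) := hsq.const_div_atTop t
      have hexp : Tendsto (fun n : ℕ => Complex.exp (Complex.I * ((t / √n : ℝ) : ℂ))) atTop
          (𝓝 1) := by
        have hcont : Continuous fun x : ℝ => Complex.exp (Complex.I * (x : ℂ)) := by fun_prop
        have h := (hcont.tendsto 0).comp hdiv
        simp only [Complex.ofReal_zero, mul_zero, Complex.exp_zero] at h
        exact h
      have hmul := (tendsto_circleEval_pow hq hsum hmean hV hV0 t).mul hexp
      rw [mul_one] at hmul
      refine hmul.congr' ?_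
      filter_upwards [hsq.eventually_ge_atTop (|t| / (Real.pi / d))] with n hn
      have ht : t ∈ Icc (-(√n * (Real.pi / d))) (√n * (Real.pi / d)) :=
        abs_le.1 ((div_le_iff₀ (by positivity)).1 hn)
      rw [hf]
      simp only [indicator_of_mem ht, hg]
  have hL : ∫ t : ℝ, Complex.exp (((-(V / 2) * t ^ 2 : ℝ) : ℂ)) = ((√(Real.pi / (V / 2)) : ℝ) : ℂ) := by
    rw [← integral_gaussian, ← integral_complex_ofReal]
    simp_rw [Complex.ofReal_exp]
  have hval : ∀ n : ℕ, 1 ≤ n → coeff (n - 1) (mk q ^ n) ≠ 0 →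
      (∫ t, f n t).re = 2 * Real.pi / d * (√n * coeff (n - 1) (mk q ^ n)) := by
    intro n hn hne
    have hsn : 0 < √(n : ℝ) := Real.sqrt_pos.2 (by exact_mod_cast hn)
    have hinv := integral_circleEval_mul_exp (hA.pow n) hd (dvd_of_coeff_pow_ne_zero hsupp n)
      (dvd_of_coeff_pow_ne_zero hsupp n _ hne)
    have hintegral : ∫ t, f n t = √n * (2 * Real.pi / d * (coeff (n - 1) (mk q ^ n) : ℝ) : ℂ) := by
      rw [hf, integral_indicator measurableSet_Icc, integral_Icc_eq_integral_Ioc,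
        ← intervalIntegral.integral_of_le (neg_le_self (by positivity)),
        intervalIntegral.integral_comp_div
          (f := fun θ : ℝ => g θ ^ n * Complex.exp (Complex.I * (θ : ℂ))) hsn.ne', ← hinv,
        Complex.real_smul, neg_div, mul_div_cancel_left₀ _ hsn.ne']
      congr 1
      refine intervalIntegral.integral_congr fun θ _ => ?_
      simp only [hg]
      rw [circleEval_pow hA, mul_pow, mul_assoc, ← Complex.exp_nat_mul, ← Complex.exp_add]
      congr 2
      push_cast [Nat.cast_sub hn]; ring
    have hreal : (√n * (2 * Real.pi / d * (coeff (n - 1) (mk q ^ n) : ℝ)) : ℂ)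
        = ((2 * Real.pi / d * (√n * coeff (n - 1) (mk q ^ n)) : ℝ) : ℂ) := by push_cast; ring
    rw [hintegral, hreal, Complex.ofReal_re]
  set L := √(Real.pi / (V / 2)) with hLdef
  have hLpos : 0 < L := Real.sqrt_pos.2 (by positivity)
  rw [hL] at hlim
  have hre : Tendsto (fun n => (∫ t, f n t).re) atTop (𝓝 L) := by
    have h := (Complex.continuous_re.tendsto _).comp hlim
    rw [Complex.ofReal_re] at h
    exact h
  have hev : ∀ᶠ n in atTop, L / 2 ≤ (∫ t, f n t).re :=
    (hre.eventually (lt_mem_nhds (half_lt_self hLpos))).mono fun _ h => h.le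
  have hb0 : ∀ n j, 0 ≤ coeff j (mk q ^ n) := coeff_pow_nonneg hq
  obtain ⟨c', hc', h⟩ := exists_forall_le_of_eventually
    (u := fun n : ℕ => √n * coeff (n - 1) (mk q ^ n)) (c := d / (2 * Real.pi) * (L / 2))
    (fun n => mul_nonneg (Real.sqrt_nonneg _) (hb0 _ _)) (by positivity) (by
      filter_upwards [hev, eventually_ge_atTop 1] with n hn hn1 hne
      have := hval n hn1 (right_ne_zero_of_mul hne)
      rw [this] at hn
      calc (d : ℝ) / (2 * Real.pi) * (L / 2)
          ≤ d / (2 * Real.pi) * (2 * Real.pi / d * (√n * coeff (n - 1) (mk q ^ n))) := by gcongr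
        _ = _ := by field_simp)
  refine ⟨c', hc', fun n hn hne => ?_⟩
  have hsn : 0 < √(n : ℝ) := Real.sqrt_pos.2 (by exact_mod_cast hn)
  rw [div_le_iff₀ hsn, mul_comm]
  exact h n (mul_ne_zero hsn.ne' hne)

end LocalLowerBound

section Trees
namespace PlaneTree

/-- The tree whose root branches are the entries of a tuple. -/
def join {k : ℕ} (v : Fin k → PlaneTree) : PlaneTree := node (List.ofFn v)

/-- A plane tree is the tuple of its root branches. -/
def joinEquiv : (Σ k, Fin k → PlaneTree) ≃ PlaneTree where
  toFun x := join x.2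
  invFun t := ⟨t.children.length, t.children.get⟩
  left_inv x := List.equivSigmaTuple.right_inv x
  right_inv t := by
    cases t with
    | node ts => simp [join, children]

theorem joinEquiv_apply (x : Σ k, Fin k → PlaneTree) : joinEquiv x = join x.2 := rfl

theorem join_induction {P : PlaneTree → Prop}
    (h : ∀ {k : ℕ} (v : Fin k → PlaneTree), (∀ i, P (v i)) → P (join v)) (t : PlaneTree) : P t := by
  refine PlaneTree.rec (motive_1 := P) (motive_2 := fun ts => ∀ t ∈ ts, P t) (fun ts ih => ?_)
    (by simp) (fun t ts ht hts => by simpa using ⟨ht, hts⟩) t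
  have := h ts.get fun i => ih _ (List.get_mem ts i)
  rwa [join, List.ofFn_get] at this

theorem nil_mem_vertexSet (t : PlaneTree) : [] ∈ vertexSet t := by
  cases t; simp [vertexSet, subtreeAt]

section Join
variable {k : ℕ} (v : Fin k → PlaneTree)

theorem subtreeAt_join_nil : subtreeAt (join v) [] = some (join v) := by
  simp [join, subtreeAt]

theorem subtreeAt_join_cons (a : Fin k) (x : List ℕ) :
    subtreeAt (join v) (a :: x) = subtreeAt (v a) x := by
  simp [join, subtreeAt]

theorem cons_mem_vertexSet_join (a : Fin k) (x : List ℕ) :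
    (a : ℕ) :: x ∈ vertexSet (join v) ↔ x ∈ vertexSet (v a) := by
  simp only [vertexSet, mem_ofPred_eq, subtreeAt_join_cons]

theorem exists_of_cons_mem_vertexSet_join {i : ℕ} {x : List ℕ}
    (h : i :: x ∈ vertexSet (join v)) : ∃ a : Fin k, (a : ℕ) = i ∧ x ∈ vertexSet (v a) := by
  by_cases hi : i < k
  · exact ⟨⟨i, hi⟩, rfl, (cons_mem_vertexSet_join v ⟨i, hi⟩ x).1 h⟩
  · simp [vertexSet, join, subtreeAt, hi] at h

theorem childCount_join_nil : childCount (join v) [] = k := by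
  simp [childCount, subtreeAt_join_nil]
  simp [join, children]

theorem childCount_join_cons (a : Fin k) (x : List ℕ) :
    childCount (join v) (a :: x) = childCount (v a) x := by
  rw [childCount, subtreeAt_join_cons, childCount]

/-- The vertices of a joined tree: the root, and the vertices of the branches. -/
noncomputable def vertexEquivJoin :
    Option (Σ a : Fin k, vertexSet (v a)) ≃ vertexSet (join v) :=
  Equiv.ofBijective
    (fun o => o.elim ⟨[], nil_mem_vertexSet _⟩
      fun x => ⟨x.1 :: x.2, (cons_mem_vertexSet_join v _ _).2 x.2.2⟩) <| by
    constructor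
    · rintro (_ | ⟨a, x, hx⟩) (_ | ⟨b, y, hy⟩) h <;> simp at h ⊢
      obtain ⟨h1, rfl⟩ := h
      obtain rfl := Fin.ext h1
      simp
    · rintro ⟨_ | ⟨i, x⟩, hx⟩
      · exact ⟨none, rfl⟩
      · obtain ⟨a, rfl, ha⟩ := exists_of_cons_mem_vertexSet_join v hx
        exact ⟨some ⟨a, x, ha⟩, rfl⟩

end Join

instance finite_vertexSet (t : PlaneTree) : Finite (vertexSet t) := by
  induction t using join_induction with
  | h v ih => exact Finite.of_equiv _ (vertexEquivJoin v)

theorem size_join {k : ℕ} (v : Fin k → PlaneTree) : size (join v) = (∑ a, size (v a)) + 1 := by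
  simp only [size, ← Nat.card_coe_set_eq]
  rw [← Nat.card_congr (vertexEquivJoin v), Finite.card_option, Nat.card_sigma]

theorem gwProb_join (p : ℕ → ℝ≥0∞) {k : ℕ} (v : Fin k → PlaneTree) :
    gwProb p (join v) = p k * ∏ a, gwProb p (v a) := by
  have := fun a => Fintype.ofFinite (vertexSet (v a))
  have := Fintype.ofFinite (vertexSet (join v))
  simp only [gwProb, ← finprod_set_coe_eq_finprod_mem, finprod_eq_prod_of_fintype]
  rw [← (vertexEquivJoin v).prod_comp, Fintype.prod_option, Fintype.prod_sigma]
  congr 1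
  · exact congrArg p (childCount_join_nil v)
  · exact Finset.prod_congr rfl fun a _ => Finset.prod_congr rfl fun x _ =>
      congrArg p (childCount_join_cons v a x)

/-- The vertices of a tree at a given depth. -/
def level (t : PlaneTree) (i : ℕ) : Set (List ℕ) := {x ∈ vertexSet t | x.length = i}

instance finite_level (t : PlaneTree) (i : ℕ) : Finite (level t i) :=
  Finite.Set.subset (vertexSet t) fun _ h => h.1

theorem card_level_zero (t : PlaneTree) : Nat.card (level t 0) = 1 := by
  have : level t 0 = {[]} := by
    ext x
    simp only [level, mem_ofPred_eq, List.length_eq_zero_iff, mem_singleton_iff]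
    exact ⟨fun h => h.2, fun h => ⟨h ▸ nil_mem_vertexSet t, h⟩⟩
  rw [this]; simp

theorem card_level_succ_join {k : ℕ} (v : Fin k → PlaneTree) (i : ℕ) :
    Nat.card (level (join v) (i + 1)) = ∑ a, Nat.card (level (v a) i) := by
  rw [← Nat.card_sigma]
  symm
  refine Nat.card_congr (Equiv.ofBijective (fun x : Σ a : Fin k, level (v a) i =>
    (⟨x.1 :: x.2, (cons_mem_vertexSet_join v _ _).2 x.2.2.1, by simp [x.2.2.2]⟩ :
      level (join v) (i + 1))) ⟨?_, ?_⟩)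
  · rintro ⟨a, x, hx⟩ ⟨b, y, hy⟩ h
    obtain ⟨h1, h2⟩ := List.cons.inj (congrArg Subtype.val h)
    dsimp only at h2
    subst h2
    obtain rfl := Fin.ext h1
    simp
  · rintro ⟨_ | ⟨i, x⟩, hx, hl⟩
    · simp at hl
    · obtain ⟨a, rfl, ha⟩ := exists_of_cons_mem_vertexSet_join v hx
      exact ⟨⟨a, x, ha, by simpa using hl⟩, rfl⟩

/-- Pairs whose path passes through the root either contain the root, or lie in two different
branches. -/
theorem rootPairCount_join_le {k : ℕ} (v : Fin k → PlaneTree) (d : ℕ) :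
    rootPairCount (join v) d ≤ Nat.card (level (join v) d) +
      ∑ i ∈ Finset.range (d - 1), ∑ a, ∑ b ∈ Finset.univ.erase a,
        Nat.card (level (v a) i) * Nat.card (level (v b) (d - 2 - i)) := by
  let f : level (join v) d ⊕ (Σ i : Finset.range (d - 1), Σ a, Σ b : Finset.univ.erase a,
      level (v a) i × level (v b) (d - 2 - i)) → Set (List ℕ) :=
    Sum.elim (fun x => {[], x.1}) fun x =>
      {(x.2.1 : ℕ) :: x.2.2.2.1.1, (x.2.2.1.1 : ℕ) :: x.2.2.2.2.1}
  have hsub : {s : Set (List ℕ) | ∃ x y, x ∈ vertexSet (join v) ∧ y ∈ vertexSet (join v) ∧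
      s = {x, y} ∧ treeDist x y = d ∧ lca x y = []} ⊆ range f := by
    rintro _ ⟨x, y, hx, hy, rfl, hd, hl⟩
    have hyx : lca y x = [] := by
      cases x <;> cases y <;> simp_all [lca, eq_comm]
    simp only [treeDist, dUp, hl, hyx, List.length_nil, Nat.sub_zero] at hd
    match x, y, hx, hy with
    | [], y, _, hy => exact ⟨Sum.inl ⟨y, hy, by simpa using hd⟩, rfl⟩
    | i :: x, [], hx, _ => exact ⟨Sum.inl ⟨i :: x, hx, by simpa using hd⟩, pair_comm _ _⟩
    | i :: x, j :: y, hx, hy =>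
      obtain ⟨a, rfl, ha⟩ := exists_of_cons_mem_vertexSet_join v hx
      obtain ⟨b, rfl, hb⟩ := exists_of_cons_mem_vertexSet_join v hy
      have hab : b ≠ a := by rintro rfl; simp [lca] at hl
      simp only [List.length_cons] at hd
      exact ⟨Sum.inr ⟨⟨x.length, by simp; omega⟩, a, ⟨b, by simpa using hab⟩, ⟨x, ha, rfl⟩,
        ⟨y, hb, by simp; omega⟩⟩, rfl⟩
  calc rootPairCount (join v) d ≤ (range f).ncard := ncard_le_ncard hsub (finite_range f)
    _ ≤ Nat.card (level (join v) d ⊕ (Σ i : Finset.range (d - 1), Σ a,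
          Σ b : Finset.univ.erase a, level (v a) i × level (v b) (d - 2 - i))) := by
      rw [← Nat.card_coe_set_eq]
      exact Finite.card_range_le f
    _ = _ := by
      simp only [Nat.card_sum, Nat.card_sigma, Nat.card_prod]
      rw [← Finset.sum_coe_sort (Finset.range (d - 1))]
      congr 1
      refine Finset.sum_congr rfl fun i _ => Finset.sum_congr rfl fun a _ => ?_
      rw [← Finset.sum_coe_sort (Finset.univ.erase a)]

end PlaneTree
end Trees

section TreeSeries
open PowerSeries PlaneTree

/-- The generating series of a weight `u` with respect to a size function `s`. -/
noncomputable def weightSeries {α : Type*} (s : α → ℕ) (u : α → ℝ≥0∞) : PowerSeries ℝ≥0∞ :=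
  mk fun n => ∑' x, if s x = n then u x else 0

theorem weightSeries_comp_equiv {α β : Type*} (e : β ≃ α) (s : α → ℕ) (u : α → ℝ≥0∞) :
    weightSeries (fun x => s (e x)) (fun x => u (e x)) = weightSeries s u := by
  ext n
  simp only [weightSeries, coeff_mk]
  exact e.tsum_eq fun x => if s x = n then u x else 0

theorem weightSeries_mul {α β : Type*} (s : α → ℕ) (u : α → ℝ≥0∞) (r : β → ℕ) (w : β → ℝ≥0∞) :
    weightSeries s u * weightSeries r w
      = weightSeries (fun x : α × β => s x.1 + r x.2) fun x => u x.1 * w x.2 := by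
  ext n
  simp only [weightSeries, coeff_mul, coeff_mk, ← ENNReal.tsum_mul_right]
  rw [← Summable.tsum_finsetSum fun _ _ => ENNReal.summable, ENNReal.tsum_prod']
  refine tsum_congr fun x => ?_
  simp only [← ENNReal.tsum_mul_left]
  rw [← Summable.tsum_finsetSum fun _ _ => ENNReal.summable]
  refine tsum_congr fun y => ?_
  by_cases h : s x + r y = n
  · rw [if_pos h, Finset.sum_eq_single (s x, r y)]
    · simp
    · rintro ⟨i, j⟩ _ hij
      by_cases hi : s x = i
      · have hj : r y ≠ j := fun hj => hij (by rw [hi, hj])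
        simp [hj]
      · simp [hi]
    · intro hn
      exact absurd (Finset.HasAntidiagonal.mem_antidiagonal.2 h) hn
  · rw [if_neg h]
    refine Finset.sum_eq_zero ?_
    rintro ⟨i, j⟩ hij
    have hij := Finset.HasAntidiagonal.mem_antidiagonal.1 hij
    by_cases hi : s x = i
    · have hj : r y ≠ j := by rintro rfl; exact h (hi ▸ hij)
      simp [hj]
    · simp [hi]

theorem prod_weightSeries {α : Type*} (s : α → ℕ) {k : ℕ} (u : Fin k → α → ℝ≥0∞) :
    ∏ a, weightSeries s (u a)
      = weightSeries (fun v : Fin k → α => ∑ a, s (v a)) fun v => ∏ a, u a (v a) := by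
  induction k with
  | zero =>
    ext n
    simp [weightSeries, coeff_one, eq_comm]
  | succ k ih =>
    rw [Fin.prod_univ_succ, ih fun a => u a.succ, weightSeries_mul,
      ← weightSeries_comp_equiv (Fin.consEquiv fun _ : Fin (k + 1) => α)]
    simp [Fin.sum_univ_succ, Fin.prod_univ_succ, Fin.consEquiv]

/-- The generating series, by size, of a nonnegative functional of the Galton–Watson tree. -/
noncomputable def treeSeries (p : ℕ → ℝ≥0∞) (f : PlaneTree → ℝ≥0∞) : PowerSeries ℝ≥0∞ :=
  weightSeries size fun t => gwProb p t * f t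

theorem coeff_succ_treeSeries (p : ℕ → ℝ≥0∞) (f : PlaneTree → ℝ≥0∞) (n : ℕ) :
    coeff (n + 1) (treeSeries p f) = ∑' k, p k * coeff n (weightSeries
      (fun v : Fin k → PlaneTree => ∑ a, size (v a))
      fun v => (∏ a, gwProb p (v a)) * f (join v)) := by
  rw [treeSeries, ← weightSeries_comp_equiv joinEquiv]
  simp only [weightSeries, coeff_mk, ← ENNReal.tsum_mul_left]
  rw [ENNReal.tsum_sigma']
  refine tsum_congr fun k => tsum_congr fun v => ?_
  simp [joinEquiv_apply, size_join, gwProb_join, mul_assoc]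

theorem coeff_zero_treeSeries (p : ℕ → ℝ≥0∞) (f : PlaneTree → ℝ≥0∞) :
    coeff 0 (treeSeries p f) = 0 := by
  rw [treeSeries, ← weightSeries_comp_equiv joinEquiv]
  simp [weightSeries, joinEquiv_apply, size_join]

theorem coeff_weightSeries_finsetSum {α ι : Type*} (s : α → ℕ) (S : Finset ι) (u : ι → α → ℝ≥0∞)
    (n : ℕ) : coeff n (weightSeries s fun x => ∑ i ∈ S, u i x)
      = ∑ i ∈ S, coeff n (weightSeries s (u i)) := by
  simp only [weightSeries, coeff_mk]
  rw [← Summable.tsum_finsetSum fun _ _ => ENNReal.summable]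
  refine tsum_congr fun x => ?_
  split_ifs <;> simp

theorem coeff_weightSeries_mono {α : Type*} (s : α → ℕ) {u w : α → ℝ≥0∞} (h : ∀ x, u x ≤ w x)
    (n : ℕ) : coeff n (weightSeries s u) ≤ coeff n (weightSeries s w) := by
  simp only [weightSeries, coeff_mk]
  refine ENNReal.tsum_le_tsum fun x => ?_
  split_ifs
  · exact h x
  · exact le_rfl

theorem coeff_weightSeries_add {α : Type*} (s : α → ℕ) (u w : α → ℝ≥0∞) (n : ℕ) :
    coeff n (weightSeries s fun x => u x + w x)
      = coeff n (weightSeries s u) + coeff n (weightSeries s w) := by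
  simp only [weightSeries, coeff_mk]
  rw [← ENNReal.tsum_add]
  refine tsum_congr fun x => ?_
  split_ifs <;> simp

section Forest
variable (p : ℕ → ℝ≥0∞)

/-- The generating series of the total progeny. -/
noncomputable def sizeSeries : PowerSeries ℝ≥0∞ := treeSeries p fun _ => 1

/-- The generating series of the number of vertices at depth `i`. -/
noncomputable def levelSeries (i : ℕ) : PowerSeries ℝ≥0∞ :=
  treeSeries p fun t => (Nat.card (level t i) : ℝ≥0∞)

/-- The derivative of the offspring generating function, composed with the series `F` of the
progeny. -/
noncomputable def derivSeries : PowerSeries ℝ≥0∞ :=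
  powSum (sizeSeries p) (fun k => k * p k) fun k => k - 1

/-- The second derivative of the offspring generating function, composed with the series of the
progeny. -/
noncomputable def derivSeries₂ : PowerSeries ℝ≥0∞ :=
  powSum (sizeSeries p) (fun k => k * (k - 1 : ℕ) * p k) fun k => k - 2

theorem coeff_sizeSeries (n : ℕ) : coeff n (sizeSeries p) = probSize p n := by
  simp [sizeSeries, treeSeries, weightSeries, probSize]

theorem sizeSeries_eq : sizeSeries p = X * powSum (sizeSeries p) p id := by
  ext n
  cases n with
  | zero => rw [coeff_zero_X_mul]; exact coeff_zero_treeSeries p _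
  | succ n =>
    rw [coeff_succ_X_mul, sizeSeries, coeff_succ_treeSeries, powSum, coeff_mk]
    refine tsum_congr fun k => ?_
    have h := prod_weightSeries size fun (_ : Fin k) => gwProb p
    simp only [Finset.prod_const, Finset.card_univ, Fintype.card_fin] at h
    simp [treeSeries, h]

theorem weightSeries_single {k : ℕ} (f : PlaneTree → ℝ≥0∞) (a : Fin k) :
    weightSeries (fun v : Fin k → PlaneTree => ∑ c, size (v c))
      (fun v => (∏ c, gwProb p (v c)) * f (v a)) = treeSeries p f * sizeSeries p ^ (k - 1) := by
  have h := prod_weightSeries size fun (c : Fin k) t => gwProb p t * if c = a then f t else 1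
  rw [← Finset.mul_prod_erase _ _ (Finset.mem_univ a)] at h
  have hc : ∀ c ∈ Finset.univ.erase a, weightSeries size (fun t => gwProb p t *
      if c = a then f t else 1) = sizeSeries p := by
    intro c hc
    rw [sizeSeries, treeSeries]
    simp [Finset.ne_of_mem_erase hc]
  rw [Finset.prod_congr rfl hc] at h
  simp only [if_true, Finset.prod_const, Finset.card_erase_of_mem, Finset.mem_univ,
    Finset.card_univ, Fintype.card_fin, Finset.prod_mul_distrib, Finset.prod_ite_eq'] at h
  exact h.symm

theorem weightSeries_pair {k : ℕ} (f g : PlaneTree → ℝ≥0∞) {a b : Fin k} (hab : b ≠ a) :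
    weightSeries (fun v : Fin k → PlaneTree => ∑ c, size (v c))
      (fun v => (∏ c, gwProb p (v c)) * (f (v a) * g (v b)))
      = treeSeries p f * treeSeries p g * sizeSeries p ^ (k - 2) := by
  have h := prod_weightSeries size fun (c : Fin k) t =>
    gwProb p t * ((if c = a then f t else 1) * if c = b then g t else 1)
  rw [← Finset.mul_prod_erase _ _ (Finset.mem_univ a),
    ← Finset.mul_prod_erase _ _ (Finset.mem_erase.2 ⟨hab, Finset.mem_univ b⟩)] at h
  have hc : ∀ c ∈ (Finset.univ.erase a).erase b, weightSeries size (fun t => gwProb p t *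
      ((if c = a then f t else 1) * if c = b then g t else 1)) = sizeSeries p := by
    intro c hc
    rw [sizeSeries, treeSeries]
    simp [Finset.ne_of_mem_erase hc, Finset.ne_of_mem_erase (Finset.mem_of_mem_erase hc)]
  rw [Finset.prod_congr rfl hc, Finset.prod_const, Finset.card_erase_of_mem
    (Finset.mem_erase.2 ⟨hab, Finset.mem_univ b⟩), Finset.card_erase_of_mem (Finset.mem_univ a)] at h
  simp only [if_true, Finset.mem_univ, hab, hab.symm, if_false, mul_one, one_mul,
    Finset.card_univ, Fintype.card_fin, Finset.prod_mul_distrib, Finset.prod_ite_eq',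
    Nat.sub_sub, Nat.reduceAdd, ← mul_assoc] at h
  rw [treeSeries, treeSeries, h]
  simp only [mul_assoc]

theorem levelSeries_succ (i : ℕ) :
    levelSeries p (i + 1) = X * (levelSeries p i * derivSeries p) := by
  ext n
  cases n with
  | zero => rw [coeff_zero_X_mul]; exact coeff_zero_treeSeries p _
  | succ n =>
    rw [coeff_succ_X_mul, derivSeries, coeff_mul_powSum, levelSeries, coeff_succ_treeSeries]
    refine tsum_congr fun k => ?_
    simp only [card_level_succ_join, Nat.cast_sum, Finset.mul_sum]
    rw [coeff_weightSeries_finsetSum]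
    simp only [weightSeries_single p fun t => (Nat.card (level t i) : ℝ≥0∞)]
    simp [levelSeries]
    ring

theorem levelSeries_eq (i : ℕ) :
    levelSeries p i = X ^ i * (derivSeries p ^ i * sizeSeries p) := by
  induction i with
  | zero => simp only [levelSeries, sizeSeries, card_level_zero, Nat.cast_one, pow_zero, one_mul]
  | succ i ih => rw [levelSeries_succ, ih]; ring

/-- The first-moment bound for pairs whose path passes through the root. -/
theorem coeff_treeSeries_rootPairCount_le (d n : ℕ) :
    coeff n (treeSeries p fun t => (rootPairCount t d : ℝ≥0∞))
      ≤ coeff n (X ^ d * (derivSeries p ^ d * sizeSeries p)) + (d - 1 : ℕ) *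
        coeff n (X ^ (d - 1) * (derivSeries p ^ (d - 2) * (derivSeries₂ p * sizeSeries p ^ 2))) := by
  rw [← levelSeries_eq]
  cases n with
  | zero => rw [coeff_zero_treeSeries]; exact zero_le
  | succ n =>
    have hpair : ∀ i ∈ Finset.range (d - 1),
        coeff (n + 1) (X ^ (d - 1) * (derivSeries p ^ (d - 2) *
          (derivSeries₂ p * sizeSeries p ^ 2)))
        = ∑' k, p k * ∑ a : Fin k, ∑ b ∈ Finset.univ.erase a, coeff n (weightSeries
            (fun v : Fin k → PlaneTree => ∑ c, size (v c)) fun v => (∏ c, gwProb p (v c)) *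
            ((Nat.card (level (v a) i) : ℝ≥0∞) * Nat.card (level (v b) (d - 2 - i)))) := by
      intro i hi
      rw [Finset.mem_range] at hi
      have hser : X ^ (d - 1) * (derivSeries p ^ (d - 2) * (derivSeries₂ p * sizeSeries p ^ 2))
          = X * (levelSeries p i * levelSeries p (d - 2 - i) * derivSeries₂ p) := by
        obtain ⟨j, rfl⟩ : ∃ j, d = i + j + 2 := ⟨d - 2 - i, by omega⟩
        rw [levelSeries_eq, levelSeries_eq, show i + j + 2 - 1 = i + j + 1 by omega,
          show i + j + 2 - 2 = i + j by omega, show i + j - i = j by omega]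
        ring
      rw [hser, coeff_succ_X_mul, derivSeries₂, coeff_mul_powSum]
      refine tsum_congr fun k => ?_
      have hab : ∀ a : Fin k, ∀ b ∈ Finset.univ.erase a, coeff n (weightSeries
            (fun v : Fin k → PlaneTree => ∑ c, size (v c)) fun v => (∏ c, gwProb p (v c)) *
            ((Nat.card (level (v a) i) : ℝ≥0∞) * Nat.card (level (v b) (d - 2 - i))))
          = coeff n (levelSeries p i * levelSeries p (d - 2 - i) * sizeSeries p ^ (k - 2)) :=
        fun a b hb => by
          rw [weightSeries_pair p (fun t => (Nat.card (level t i) : ℝ≥0∞))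
            (fun t => (Nat.card (level t (d - 2 - i)) : ℝ≥0∞)) (Finset.ne_of_mem_erase hb)]
          rfl
      rw [Finset.sum_congr rfl fun a _ => Finset.sum_congr rfl (hab a)]
      simp only [Finset.sum_const, Finset.card_erase_of_mem, Finset.mem_univ, Finset.card_univ,
        Fintype.card_fin, nsmul_eq_mul]
      ring
    have hsum := Finset.sum_congr rfl hpair
    rw [Finset.sum_const, Finset.card_range, nsmul_eq_mul] at hsum
    rw [hsum, ← Summable.tsum_finsetSum fun _ _ => ENNReal.summable, levelSeries,
      coeff_succ_treeSeries, coeff_succ_treeSeries, ← ENNReal.tsum_add]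
    refine ENNReal.tsum_le_tsum fun k => ?_
    simp only [← Finset.mul_sum]
    rw [← mul_add]
    gcongr
    simp only [← coeff_weightSeries_finsetSum, ← coeff_weightSeries_add, ← Finset.mul_sum,
      ← mul_add]
    refine coeff_weightSeries_mono _ (fun v => ?_) n
    gcongr
    simp only [Finset.mul_sum]
    exact_mod_cast rootPairCount_join_le v d

end Forest
end TreeSeries

section Moments
open PowerSeries

theorem ENNReal.hasSum_toReal_of_tsum_eq {α : Type*} {f : α → ℝ≥0∞} {a : ℝ≥0∞}
    (h : ∑' x, f x = a) (ha : a ≠ ⊤) : HasSum (fun x => (f x).toReal) a.toReal := by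
  have hf : ∑' x, f x ≠ ⊤ := h ▸ ha
  have := ENNReal.hasSum_toReal hf
  rwa [← ENNReal.tsum_toReal_eq fun x => ENNReal.ne_top_of_tsum_ne_top hf x, h] at this

theorem coeff_mk_pow_eq_ofReal {p : ℕ → ℝ≥0∞} (hp : ∀ k, p k ≠ ⊤) (N j : ℕ) :
    coeff j (mk p ^ N) = ENNReal.ofReal (coeff j (mk (fun k => (p k).toReal) ^ N)) := by
  have h1 : mk p = map ENNReal.ofNNRealHom (mk fun k => (p k).toNNReal) := by
    ext k; simp [ENNReal.coe_toNNReal (hp k)]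
  have h2 : mk (fun k => (p k).toReal) = map NNReal.toRealHom (mk fun k => (p k).toNNReal) := by
    ext k; simp [ENNReal.toReal]
  rw [h1, h2, ← map_pow, ← map_pow, coeff_map, coeff_map]
  simp

/-- A sequence bounded both by `A / N` and by `A r ^ l 2 ^ N` is `O(1 / (N + l + 1))`. -/
theorem exists_forall_add_mul_le {r A : ℝ} (hr0 : 0 ≤ r) (hr1 : r < 1) (hA : 0 ≤ A) :
    ∃ B, 0 ≤ B ∧ ∀ (N l : ℕ) (y : ℝ), 0 ≤ y → N * y ≤ A → y ≤ A * r ^ l * 2 ^ N →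
      (N + l + 1) * y ≤ B := by
  obtain ⟨J, hJ⟩ := exists_pow_lt_of_lt_one (show (0 : ℝ) < 1 / 2 by norm_num) hr1
  have hJ1 : 1 ≤ J := by
    rcases Nat.eq_zero_or_pos J with rfl | h
    · norm_num at hJ
    · exact h
  have hs1 : √r < 1 := by rw [Real.sqrt_lt' one_pos]; simpa using hr1
  have hs0 := Real.sqrt_nonneg r
  obtain ⟨M, hM⟩ : ∃ M, ∀ l : ℕ, ((l : ℝ) + 1) * √r ^ l ≤ M := by
    have h1 := tendsto_self_mul_const_pow_of_lt_one hs0 hs1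
    have h2 := h1.add (tendsto_pow_atTop_nhds_zero_of_lt_one hs0 hs1)
    obtain ⟨M, hM⟩ := h2.bddAbove_range
    exact ⟨M, fun l => by rw [add_mul, one_mul]; exact hM ⟨l, rfl⟩⟩
  have hM0 : 0 ≤ M := le_trans (by positivity) (hM 0)
  refine ⟨2 * A * M + (2 * J + 2) * A, by positivity, fun N l y hy h1 h2 => ?_⟩
  rcases le_or_gt (2 * J * N) l with hl | hl
  · have hs : √r ^ l * 2 ^ N ≤ 1 := by
      calc √r ^ l * 2 ^ N ≤ √r ^ (2 * J * N) * 2 ^ N := by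
            gcongr ?_ * _; exact pow_le_pow_of_le_one hs0 hs1.le hl
        _ = (r ^ J * 2) ^ N := by
            rw [mul_assoc, pow_mul, Real.sq_sqrt hr0, pow_mul, mul_pow]
        _ ≤ 1 := pow_le_one₀ (by positivity) (by linarith)
    have hy' : y ≤ A * √r ^ l := by
      calc y ≤ A * r ^ l * 2 ^ N := h2
        _ = A * √r ^ l * (√r ^ l * 2 ^ N) := by
            nth_rw 1 [← Real.mul_self_sqrt hr0]; rw [mul_pow]; ring
        _ ≤ A * √r ^ l * 1 := by gcongr
        _ = _ := mul_one _
    have hN : (N : ℝ) ≤ l := by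
      have : N ≤ l := le_trans (by nlinarith) hl
      exact_mod_cast this
    calc (N + l + 1) * y ≤ (2 * (l + 1)) * (A * √r ^ l) := by gcongr; linarith
      _ = 2 * A * ((l + 1) * √r ^ l) := by ring
      _ ≤ 2 * A * M := by gcongr; exact hM l
      _ ≤ _ := le_add_of_nonneg_right (by positivity)
  · have hN : 1 ≤ N := by
      rcases Nat.eq_zero_or_pos N with rfl | h
      · simp at hl
      · exact h
    have hle : (N + l + 1 : ℝ) ≤ (2 * J + 2) * N := by
      have : N + l + 1 ≤ (2 * J + 2) * N := by nlinarith
      exact_mod_cast this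
    calc (N + l + 1) * y ≤ (2 * J + 2) * N * y := by gcongr
      _ = (2 * J + 2) * (N * y) := by ring
      _ ≤ (2 * J + 2) * A := by gcongr
      _ ≤ _ := le_add_of_nonneg_left (by positivity)

theorem HasSum.eq_zero_of_mul_nonneg {f g : ℕ → ℝ} {V : ℝ} (hf : HasSum f 0)
    (hg : HasSum (fun k => g k * f k) V) (h : ∀ k, 0 ≤ f k) : V = 0 := by
  have hf0 : f = 0 := (hasSum_zero_iff_of_nonneg h).1 hf
  refine hg.unique ?_
  simp [hf0, hasSum_zero]

section Critical
variable {q : ℕ → ℝ}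

/-- A critical nondegenerate offspring law charges `0`. -/
theorem zero_pos_of_critical (hq : ∀ k, 0 ≤ q k) (hsum : HasSum q 1)
    (hmean : HasSum (fun k : ℕ => k * q k) 1) {V : ℝ}
    (hV : HasSum (fun k : ℕ => ((k : ℝ) - 1) ^ 2 * q k) V) (hV0 : V ≠ 0) : 0 < q 0 := by
  refine lt_of_le_of_ne (hq 0) fun h0 => hV0 ?_
  have hd : HasSum (fun k : ℕ => ((k : ℝ) - 1) * q k) 0 := by
    simpa [sub_mul] using hmean.sub hsum
  refine hd.eq_zero_of_mul_nonneg (g := fun k => (k : ℝ) - 1) (by simpa [sq, mul_assoc] using hV)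
    fun k => ?_
  rcases Nat.eq_zero_or_pos k with rfl | hk
  · simp [← h0]
  · have : (1 : ℝ) ≤ k := by exact_mod_cast hk
    exact mul_nonneg (by linarith) (hq k)

/-- A critical nondegenerate offspring law charges some integer larger than `1`. -/
theorem exists_two_le_pos_of_critical (hq : ∀ k, 0 ≤ q k) (hsum : HasSum q 1)
    (hmean : HasSum (fun k : ℕ => k * q k) 1) {V : ℝ}
    (hV : HasSum (fun k : ℕ => ((k : ℝ) - 1) ^ 2 * q k) V) (hV0 : V ≠ 0) :
    ∃ K, 2 ≤ K ∧ 0 < q K := by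
  by_contra! hc
  refine hV0 ?_
  have hd : HasSum (fun k : ℕ => (1 - (k : ℝ)) * q k) 0 := by
    simpa [sub_mul] using hsum.sub hmean
  refine hd.eq_zero_of_mul_nonneg (g := fun k => 1 - (k : ℝ)) ?_ fun k => ?_
  · convert hV using 2; ring
  rcases Nat.lt_or_ge k 2 with hk | hk
  · have : (k : ℝ) ≤ 1 := by exact_mod_cast Nat.le_of_lt_succ hk
    exact mul_nonneg (by linarith) (hq k)
  · rw [le_antisymm (hc k hk) (hq k), mul_zero]

end Critical

end Moments

section Assembly
open PowerSeries

variable {p : ℕ → ℝ≥0∞}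

/-- The coefficients of `F ^ m` satisfy `O(1 / N)` and geometric bounds, uniformly in `m`. -/
theorem exists_coeff_sizeSeries_pow_le (hp : ∀ k, p k ≠ ⊤) {C : ℝ}
    (hC : ∀ N j : ℕ, 1 ≤ N →
      ((N : ℝ) - j) * coeff j (mk (fun k => (p k).toReal) ^ N) ≤ C) :
    ∃ A : ℝ≥0∞, A ≠ ⊤ ∧ ∀ N m : ℕ, N * coeff N (sizeSeries p ^ m) ≤ A ∧
      coeff N (sizeSeries p ^ m) ≤ A * 2 ^ N * 2⁻¹ ^ m := by
  refine ⟨max 1 (ENNReal.ofReal C), by simp, fun N m => ?_⟩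
  rcases lt_or_ge N m with h | h
  · simp [coeff_pow_eq_zero_of_fixed (sizeSeries_eq p) h]
  have h1 : (N : ℝ≥0∞) * coeff N (sizeSeries p ^ m) ≤ max 1 (ENNReal.ofReal C) := by
    rcases Nat.eq_zero_or_pos N with rfl | hN
    · simp
    rw [natCast_mul_coeff_pow_of_fixed (sizeSeries_eq p) h, coeff_mk_pow_eq_ofReal hp,
      ← ENNReal.ofReal_natCast, ← ENNReal.ofReal_mul (Nat.cast_nonneg m)]
    refine le_max_of_le_right (ENNReal.ofReal_le_ofReal ?_)
    have := hC N (N - m) hN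
    rwa [Nat.cast_sub h, sub_sub_cancel] at this
  refine ⟨h1, ?_⟩
  have h2 : coeff N (sizeSeries p ^ m) ≤ max 1 (ENNReal.ofReal C) := by
    rcases Nat.eq_zero_or_pos N with rfl | hN
    · obtain rfl : m = 0 := by omega
      simp
    · exact le_trans (le_mul_of_one_le_left zero_le (by exact_mod_cast hN)) h1
  refine h2.trans ?_
  rw [mul_assoc]
  refine le_mul_of_one_le_right zero_le ?_
  rw [← ENNReal.inv_pow]
  calc (1 : ℝ≥0∞) = 2 ^ m * (2 ^ m)⁻¹ := (ENNReal.mul_inv_cancel (by simp) (by simp)).symm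
    _ ≤ 2 ^ N * (2 ^ m)⁻¹ := by gcongr; norm_num

/-- The derivative of the offspring generating function is less than `1` at `1/2`. -/
theorem tsum_deriv_half_lt_one (hmean : ∑' k : ℕ, (k : ℝ≥0∞) * p k = 1) {K : ℕ} (hK : 2 ≤ K)
    (hpK : p K ≠ 0) : ∑' k : ℕ, (k : ℝ≥0∞) * p k * 2⁻¹ ^ (k - 1) < 1 := by
  have hle : ∀ k : ℕ, (k : ℝ≥0∞) * p k * 2⁻¹ ^ (k - 1) ≤ k * p k := fun k =>
    mul_le_of_le_one_right' (pow_le_one₀ zero_le (by simp))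
  have hK0 : (K : ℝ≥0∞) * p K ≠ 0 := mul_ne_zero (by simp; omega) hpK
  have hfin : (K : ℝ≥0∞) * p K ≠ ⊤ :=
    ENNReal.ne_top_of_tsum_ne_top (hmean ▸ ENNReal.one_ne_top) K
  have hlt : (K : ℝ≥0∞) * p K * 2⁻¹ ^ (K - 1) < K * p K := by
    conv_rhs => rw [← mul_one ((K : ℝ≥0∞) * p K)]
    exact ENNReal.mul_lt_mul_right hK0 hfin (pow_lt_one₀ zero_le (by simp) (by omega))
  calc _ < ∑' k : ℕ, (k : ℝ≥0∞) * p k := ENNReal.tsum_lt_tsum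
        (ne_top_of_le_ne_top (hmean ▸ ENNReal.one_ne_top) (ENNReal.tsum_le_tsum hle)) hle hlt
    _ = 1 := hmean

/-- If `F ^ m G` satisfies `O(1 / N)` and geometric bounds, then the coefficient of `z ^ N` in
`F ^ m D ^ l G`, where `D` is the derivative series, is `O(1 / (N + l + 1))`. -/
theorem exists_coeff_derivSeries_pow_le (hmean : ∑' k : ℕ, (k : ℝ≥0∞) * p k = 1) {K : ℕ}
    (hK : 2 ≤ K) (hpK : p K ≠ 0) {G : PowerSeries ℝ≥0∞} {A : ℝ≥0∞} (hA : A ≠ ⊤)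
    (h : ∀ N m : ℕ, N * coeff N (sizeSeries p ^ m * G) ≤ A ∧
      coeff N (sizeSeries p ^ m * G) ≤ A * 2 ^ N * 2⁻¹ ^ m) :
    ∃ B : ℝ≥0∞, B ≠ ⊤ ∧ ∀ N l m : ℕ,
      ((N + l + 1 : ℕ) : ℝ≥0∞) * coeff N (sizeSeries p ^ m * (derivSeries p ^ l * G)) ≤ B := by
  set ρ := ∑' k : ℕ, (k : ℝ≥0∞) * p k * 2⁻¹ ^ (k - 1) with hρdef
  have hρ : ρ < 1 := tsum_deriv_half_lt_one hmean hK hpK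
  obtain ⟨B, hB0, hB⟩ := exists_forall_add_mul_le (r := ρ.toReal) (A := A.toReal)
    ENNReal.toReal_nonneg (ENNReal.toReal_lt_of_lt_ofReal (by simpa using hρ))
    ENNReal.toReal_nonneg
  refine ⟨ENNReal.ofReal B, ENNReal.ofReal_ne_top, fun N l m => ?_⟩
  have hfin : A * ρ ^ l * 2 ^ N ≠ ⊤ := by
    have := hρ.ne_top
    finiteness
  have hgeom : coeff N (sizeSeries p ^ m * (derivSeries p ^ l * G)) ≤ A * ρ ^ l * 2 ^ N := by
    refine (coeff_pow_mul_powSum_pow_le (fun m => (h N m).2) _ _ l m).trans ?_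
    rw [← hρdef, mul_right_comm A]
    exact mul_le_of_le_one_right' (pow_le_one₀ zero_le (by simp))
  have hinv : N * coeff N (sizeSeries p ^ m * (derivSeries p ^ l * G)) ≤ A := by
    rcases Nat.eq_zero_or_pos N with rfl | hN
    · simp
    have hN0 : (N : ℝ≥0∞) ≠ 0 := by simp; omega
    have hle : ∀ m, coeff N (sizeSeries p ^ m * G) ≤ A / N * 1 ^ m := fun m => by
      rw [one_pow, mul_one, ENNReal.le_div_iff_mul_le (Or.inl hN0) (by simp), mul_comm]
      exact (h N m).1
    have := coeff_pow_mul_powSum_pow_le hle (fun k => k * p k) (fun k => k - 1) l m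
    simp only [one_pow, mul_one, hmean] at this
    rw [mul_comm]
    exact (ENNReal.le_div_iff_mul_le (Or.inl hN0) (by simp)).1 this
  have hy : coeff N (sizeSeries p ^ m * (derivSeries p ^ l * G)) ≠ ⊤ :=
    ne_top_of_le_ne_top hfin hgeom
  have := hB N l (coeff N (sizeSeries p ^ m * (derivSeries p ^ l * G))).toReal
    ENNReal.toReal_nonneg (by simpa using ENNReal.toReal_mono hA hinv)
    (by simpa using ENNReal.toReal_mono hfin hgeom)
  rw [← ENNReal.ofReal_toReal hy, ← ENNReal.ofReal_natCast,
    ← ENNReal.ofReal_mul (Nat.cast_nonneg _)]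
  exact ENNReal.ofReal_le_ofReal (by exact_mod_cast this)

theorem tsum_factorial_moment_ne_top
    (hmean : ∑' k : ℕ, (k : ℝ≥0∞) * p k = 1) (hvar : xiVar p ≠ ⊤) :
    ∑' k : ℕ, (k : ℝ≥0∞) * (k - 1 : ℕ) * p k ≠ ⊤ := by
  have hle : ∀ k : ℕ, (k : ℝ≥0∞) * (k - 1 : ℕ) * p k
      ≤ p k * ENNReal.ofReal (((k : ℝ) - 1) ^ 2) + k * p k := by
    intro k
    rcases Nat.eq_zero_or_pos k with rfl | hk
    · simp
    have h1 : ENNReal.ofReal (((k : ℝ) - 1) ^ 2) = ((k - 1 : ℕ) : ℝ≥0∞) ^ 2 := by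
      rw [← ENNReal.ofReal_natCast, ← ENNReal.ofReal_pow (Nat.cast_nonneg _), Nat.cast_sub hk,
        Nat.cast_one]
    obtain ⟨j, rfl⟩ : ∃ j, k = j + 1 := ⟨k - 1, by omega⟩
    rw [h1, Nat.add_sub_cancel]
    calc ((j + 1 : ℕ) : ℝ≥0∞) * j * p (j + 1) = p (j + 1) * (j : ℝ≥0∞) ^ 2 + j * p (j + 1) := by
          push_cast; ring
      _ ≤ _ := by gcongr; omega
  refine ne_top_of_le_ne_top ?_ (ENNReal.tsum_le_tsum hle)
  rw [ENNReal.tsum_add, hmean]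
  exact ENNReal.add_ne_top.2 ⟨hvar, ENNReal.one_ne_top⟩

/-- Multiplication by the second derivative series preserves `O(1 / N)` and geometric bounds. -/
theorem exists_coeff_derivSeries₂_le (hfact : ∑' k : ℕ, (k : ℝ≥0∞) * (k - 1 : ℕ) * p k ≠ ⊤)
    {G : PowerSeries ℝ≥0∞} {A : ℝ≥0∞} (hA : A ≠ ⊤)
    (h : ∀ N m : ℕ, N * coeff N (sizeSeries p ^ m * G) ≤ A ∧
      coeff N (sizeSeries p ^ m * G) ≤ A * 2 ^ N * 2⁻¹ ^ m) :
    ∃ A' : ℝ≥0∞, A' ≠ ⊤ ∧ ∀ N m : ℕ,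
      N * coeff N (sizeSeries p ^ m * (derivSeries₂ p * G)) ≤ A' ∧
      coeff N (sizeSeries p ^ m * (derivSeries₂ p * G)) ≤ A' * 2 ^ N * 2⁻¹ ^ m := by
  refine ⟨A * ∑' k : ℕ, (k : ℝ≥0∞) * (k - 1 : ℕ) * p k, ENNReal.mul_ne_top hA hfact,
    fun N m => ⟨?_, ?_⟩⟩
  · rcases Nat.eq_zero_or_pos N with rfl | hN
    · simp
    have hN0 : (N : ℝ≥0∞) ≠ 0 := by simp; omega
    have hle : ∀ m, coeff N (sizeSeries p ^ m * G) ≤ A / N * 1 ^ m := fun m => by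
      rw [one_pow, mul_one, ENNReal.le_div_iff_mul_le (Or.inl hN0) (by simp), mul_comm]
      exact (h N m).1
    have := coeff_pow_mul_powSum_le hle (fun k => k * (k - 1 : ℕ) * p k) (fun k => k - 2) m
    simp only [one_pow, mul_one, ENNReal.mul_div_right_comm.symm] at this
    rw [mul_comm]
    exact (ENNReal.le_div_iff_mul_le (Or.inl hN0) (by simp)).1 this
  · refine (coeff_pow_mul_powSum_le (fun m => (h N m).2) _ _ m).trans ?_
    rw [mul_right_comm A]
    gcongr _ * ?_ * _ * _
    exact ENNReal.tsum_le_tsum fun k =>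
      mul_le_of_le_one_right' (pow_le_one₀ zero_le ENNReal.one_half_lt_one.le)

theorem natCast_mul_coeff_X_pow_mul_le {B : ℝ≥0∞} {H : PowerSeries ℝ≥0∞} {d n : ℕ}
    (h : ∀ N, ((N + d : ℕ) : ℝ≥0∞) * coeff N H ≤ B) : n * coeff n (X ^ d * H) ≤ B := by
  rw [coeff_X_pow_mul']
  split_ifs with hd
  · simpa [Nat.sub_add_cancel hd] using h (n - d)
  · simp

theorem natCast_mul_coeff_derivSeries_pow_le {B : ℝ≥0∞} {G : PowerSeries ℝ≥0∞} {m : ℕ}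
    (h : ∀ N l m : ℕ,
      ((N + l + 1 : ℕ) : ℝ≥0∞) * coeff N (sizeSeries p ^ m * (derivSeries p ^ l * G)) ≤ B)
    {d l : ℕ} (hd : d ≤ l + 1) (n : ℕ) :
    n * coeff n (X ^ d * (derivSeries p ^ l * (G * sizeSeries p ^ m))) ≤ B := by
  refine natCast_mul_coeff_X_pow_mul_le fun N => le_trans ?_ (h N l m)
  rw [show sizeSeries p ^ m * (derivSeries p ^ l * G)
    = derivSeries p ^ l * (G * sizeSeries p ^ m) by ring]
  gcongr ?_ * _
  exact_mod_cast (by omega : N + d ≤ N + l + 1)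

end Assembly

/-- Theorem 7 of Devroye–Janson.  `E Q_k(T_n) ≤ C k √n` uniformly in
`k, n ≥ 1`. -/
theorem expected_rootPairCount_le
    (p : ℕ → ℝ≥0∞) (hp : ∑' k : ℕ, p k = 1)
    (hmean : ∑' k : ℕ, (k : ℝ≥0∞) * p k = 1)
    (hvar_pos : 0 < xiVar p) (hvar_fin : xiVar p ≠ ⊤) :
    ∃ C : ℝ, 0 < C ∧ ∀ k n : ℕ, 1 ≤ k → 1 ≤ n → probSize p n ≠ 0 →
      condExp p n (fun t => (rootPairCount t k : ℝ≥0∞))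
        ≤ ENNReal.ofReal (C * k * Real.sqrt n) := by
  have hpt : ∀ k, p k ≠ ⊤ := ENNReal.ne_top_of_tsum_ne_top (hp ▸ ENNReal.one_ne_top)
  have hq : ∀ k, 0 ≤ (p k).toReal := fun k => ENNReal.toReal_nonneg
  have hsum : HasSum (fun k => (p k).toReal) 1 := by
    simpa using ENNReal.hasSum_toReal_of_tsum_eq hp ENNReal.one_ne_top
  have hmean' : HasSum (fun k : ℕ => k * (p k).toReal) 1 := by
    simpa using ENNReal.hasSum_toReal_of_tsum_eq hmean ENNReal.one_ne_top
  have hV : HasSum (fun k : ℕ => ((k : ℝ) - 1) ^ 2 * (p k).toReal) (xiVar p).toReal := by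
    have := ENNReal.hasSum_toReal_of_tsum_eq (a := xiVar p) rfl hvar_fin
    simpa only [ENNReal.toReal_mul, ENNReal.toReal_ofReal (sq_nonneg _), mul_comm] using this
  have hV0 : 0 < (xiVar p).toReal := ENNReal.toReal_pos hvar_pos.ne' hvar_fin
  have hq0 := zero_pos_of_critical hq hsum hmean' hV hV0.ne'
  obtain ⟨K, hK, hqK⟩ := exists_two_le_pos_of_critical hq hsum hmean' hV hV0.ne'
  have hpK : p K ≠ 0 := fun h => by simp [h] at hqK
  obtain ⟨U, -, hU⟩ := exists_sub_mul_coeff_pow_le hq hsum hmean' hV hV0 hq0 (by omega) hqK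
  obtain ⟨c, hc, hlow⟩ := exists_le_coeff_pow hq hsum hmean' hV hV0 hq0 (by omega) hqK
  obtain ⟨A, hA, hAle⟩ := exists_coeff_sizeSeries_pow_le hpt hU
  have hAle' : ∀ N m : ℕ, N * PowerSeries.coeff N (sizeSeries p ^ m * 1) ≤ A ∧
      PowerSeries.coeff N (sizeSeries p ^ m * 1) ≤ A * 2 ^ N * 2⁻¹ ^ m := by simpa using hAle
  obtain ⟨A₂, hA₂, hAle₂⟩ := exists_coeff_derivSeries₂_le
    (tsum_factorial_moment_ne_top hmean hvar_fin) hA hAle'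
  obtain ⟨B₁, hB₁, hle₁⟩ := exists_coeff_derivSeries_pow_le hmean hK hpK hA hAle'
  obtain ⟨B₂, hB₂, hle₂⟩ := exists_coeff_derivSeries_pow_le hmean hK hpK hA₂ hAle₂
  set B := (B₁ + B₂).toReal + 1 with hB
  have hB0 : 0 < B := by positivity
  have hBle : B₁ + B₂ ≤ ENNReal.ofReal B := by
    rw [ENNReal.le_ofReal_iff_toReal_le (by finiteness) hB0.le, hB]
    linarith
  refine ⟨B / c, by positivity, fun k n hk hn hne => ?_⟩
  have hn0 : (n : ℝ≥0∞) ≠ 0 := by simp; omega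
  have hsqrt : 0 < √(n : ℝ) := Real.sqrt_pos.2 (by exact_mod_cast hn)
  have hnum : n * PowerSeries.coeff n (treeSeries p fun t => (rootPairCount t k : ℝ≥0∞))
      ≤ ENNReal.ofReal (k * B) := by
    have h₁ := natCast_mul_coeff_derivSeries_pow_le (m := 1) hle₁ (d := k) (l := k) (by omega) n
    have h₂ := natCast_mul_coeff_derivSeries_pow_le (m := 2) hle₂ (d := k - 1) (l := k - 2) (by omega) n
    rw [one_mul, pow_one] at h₁
    rw [mul_one] at h₂
    calc _ ≤ _ := mul_le_mul_right (coeff_treeSeries_rootPairCount_le p k n) _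
      _ ≤ B₁ + (k - 1 : ℕ) * B₂ := by
        rw [mul_add, mul_left_comm (n : ℝ≥0∞)]
        gcongr
      _ ≤ k * B₁ + k * B₂ := by
        gcongr
        · exact le_mul_of_one_le_left zero_le (by exact_mod_cast hk)
        · omega
      _ = k * (B₁ + B₂) := (mul_add _ _ _).symm
      _ ≤ k * ENNReal.ofReal B := by gcongr
      _ = _ := by rw [ENNReal.ofReal_mul (Nat.cast_nonneg _), ENNReal.ofReal_natCast]
  have hden : ENNReal.ofReal (c / √n) ≤ n * probSize p n := by
    have h := natCast_mul_coeff_pow_of_fixed (sizeSeries_eq p) hn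
    rw [pow_one, coeff_sizeSeries, coeff_mk_pow_eq_ofReal hpt, Nat.cast_one, one_mul] at h
    rw [h]
    refine ENNReal.ofReal_le_ofReal (hlow n hn fun h0 => ?_)
    rw [h0, ENNReal.ofReal_zero, mul_eq_zero] at h
    exact h.elim hn0 hne
  have hcond : condExp p n (fun t => (rootPairCount t k : ℝ≥0∞))
      = PowerSeries.coeff n (treeSeries p fun t => (rootPairCount t k : ℝ≥0∞)) / probSize p n := by
    simp [condExp, treeSeries, weightSeries]
  rw [hcond]
  refine ENNReal.div_le_of_le_mul ?_
  rw [← ENNReal.mul_le_mul_iff_right hn0 (ENNReal.natCast_ne_top n)]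
  calc _ ≤ ENNReal.ofReal (k * B) := hnum
    _ = ENNReal.ofReal (B / c * k * √n) * ENNReal.ofReal (c / √n) := by
      rw [← ENNReal.ofReal_mul (by positivity)]
      congr 1
      field_simp
    _ ≤ ENNReal.ofReal (B / c * k * √n) * (n * probSize p n) := by gcongr
    _ = _ := by ring
end

section
/- There exist constants C > 0 and c > 0 (depending only on the distribution of ξ) such that for all integers ℓ ≥ 1 and n ≥ 1, the total progeny W_ℓ of a Galton–Watson process started with ℓ individuals and with offspring distribution ξ satisfies P(W_ℓ = n) ≤ C ℓ n^{−3/2} exp(−c ℓ²/n); in particular P(W_ℓ = n) ≤ C' n^{−1} for some constant C'. -/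
open scoped ENNReal BigOperators
open Set Filter

/-- `P(W_ℓ = n)`: the probability that the total progeny of a Galton–Watson process
started with `ℓ` individuals (i.e. the total size of `ℓ` independent Galton–Watson
trees) equals `n`. -/
noncomputable def probTotalProgeny (p : ℕ → ℝ≥0∞) (l n : ℕ) : ℝ≥0∞ :=
  ∑' f : Fin l → PlaneTree,
    if (∑ i, PlaneTree.size (f i)) = n then ∏ i, gwProb p (f i) else 0

namespace PlaneTree

theorem vertexSet_node_ofFn {k : ℕ} (g : Fin k → PlaneTree) :
    vertexSet (node (List.ofFn g)) =
      insert [] (⋃ i : Fin k, (fun q => (i : ℕ) :: q) '' vertexSet (g i)) := by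
  ext q
  cases q with
  | nil => simp [vertexSet, subtreeAt]
  | cons a q =>
    by_cases ha : a < k
    · have : (List.ofFn g)[a]? = some (g ⟨a, ha⟩) := by simp [ha]
      simp only [vertexSet, subtreeAt, this, mem_ofPred_eq, mem_insert_iff, mem_iUnion, mem_image,
        List.cons.injEq, reduceCtorEq, false_or]
      constructor
      · exact fun h => ⟨⟨a, ha⟩, q, h, rfl, rfl⟩
      · rintro ⟨i, q', h, rfl, rfl⟩
        exact h
    · have : (List.ofFn g)[a]? = none := by simp [ha]
      simp only [vertexSet, subtreeAt, this, mem_ofPred_eq, mem_insert_iff, mem_iUnion, mem_image,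
        List.cons.injEq, reduceCtorEq, false_or, Option.isSome_none, Bool.false_eq_true, false_iff]
      rintro ⟨i, q', -, rfl, -⟩
      exact ha i.2

theorem finite_vertexSet_s8 : ∀ t : PlaneTree, (vertexSet t).Finite
  | .node ts => by
    have ih : ∀ t ∈ ts, (vertexSet t).Finite := fun t _ => finite_vertexSet_s8 t
    rw [← List.ofFn_get ts, vertexSet_node_ofFn]
    exact (finite_iUnion fun i => (ih _ (List.get_mem _ _)).image _).insert _

@[to_additive]
theorem finprod_mem_vertexSet_node_ofFn {M : Type*} [CommMonoid M] {k : ℕ}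
    (g : Fin k → PlaneTree) (f : List ℕ → M) :
    ∏ᶠ v ∈ vertexSet (node (List.ofFn g)), f v =
      f [] * ∏ i : Fin k, ∏ᶠ v ∈ vertexSet (g i), f ((i : ℕ) :: v) := by
  have hfin : ∀ i : Fin k, ((fun q => (i : ℕ) :: q) '' vertexSet (g i)).Finite :=
    fun i => (finite_vertexSet_s8 _).image _
  rw [vertexSet_node_ofFn, finprod_mem_insert _ (by simp) (finite_iUnion hfin),
    finprod_mem_iUnion _ hfin, finprod_eq_prod_of_fintype]
  · congr 1
    refine Finset.prod_congr rfl fun i _ => ?_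
    rw [finprod_mem_image]
    exact fun x _ y _ h => by simpa using h
  · intro i j hij
    rw [Function.onFun, Set.disjoint_left]
    rintro _ ⟨q, -, rfl⟩ ⟨q', -, h⟩
    simp only [List.cons.injEq] at h
    exact hij (Fin.ext h.1.symm)

theorem size_node_ofFn {k : ℕ} (g : Fin k → PlaneTree) :
    size (node (List.ofFn g)) = 1 + ∑ i, size (g i) := by
  simp only [size, ← finsum_one, finsum_mem_vertexSet_node_ofFn]

theorem size_pos (t : PlaneTree) : 0 < size t :=
  (ncard_pos (finite_vertexSet_s8 t)).2 ⟨[], by simp [vertexSet, subtreeAt]⟩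

/-- A plane tree is given by the tuple of subtrees hanging off its root. -/
def equivSigmaTuple : (Σ k : ℕ, Fin k → PlaneTree) ≃ PlaneTree :=
  List.equivSigmaTuple.symm.trans ⟨node, children, fun _ => rfl, fun ⟨_⟩ => rfl⟩

theorem equivSigmaTuple_mk {k : ℕ} (g : Fin k → PlaneTree) :
    equivSigmaTuple ⟨k, g⟩ = node (List.ofFn g) := rfl

end PlaneTree

open PlaneTree

theorem gwProb_node_ofFn (p : ℕ → ℝ≥0∞) {k : ℕ} (g : Fin k → PlaneTree) :
    gwProb p (node (List.ofFn g)) = p k * ∏ i, gwProb p (g i) := by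
  rw [gwProb, finprod_mem_vertexSet_node_ofFn]
  congr 1
  · simp [childCount, subtreeAt, children]
  · refine Finset.prod_congr rfl fun i _ => finprod_mem_congr rfl fun v _ => ?_
    simp [childCount, subtreeAt]

theorem probTotalProgeny_zero_zero (p : ℕ → ℝ≥0∞) : probTotalProgeny p 0 0 = 1 := by
  simp [probTotalProgeny]

theorem probTotalProgeny_of_lt (p : ℕ → ℝ≥0∞) {l n : ℕ} (h : n < l) :
    probTotalProgeny p l n = 0 := by
  refine ENNReal.tsum_eq_zero.2 fun f => if_neg ?_
  have : ∑ _i : Fin l, 1 ≤ ∑ i, size (f i) := Finset.sum_le_sum fun i _ => size_pos (f i)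
  simp at this
  omega

theorem probTotalProgeny_zero_succ (p : ℕ → ℝ≥0∞) (n : ℕ) :
    probTotalProgeny p 0 (n + 1) = 0 := by
  simp [probTotalProgeny]

/-- Exploring the root of the first tree replaces it by the trees hanging off it. -/
theorem probTotalProgeny_succ_succ (p : ℕ → ℝ≥0∞) (l n : ℕ) :
    probTotalProgeny p (l + 1) (n + 1) = ∑' k, p k * probTotalProgeny p (k + l) n := by
  unfold probTotalProgeny
  rw [← (Fin.consEquiv fun _ => PlaneTree).tsum_eq, ENNReal.tsum_prod',
    ← equivSigmaTuple.tsum_eq, ENNReal.tsum_sigma']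
  refine tsum_congr fun k => ?_
  rw [← (Fin.appendEquiv k l).tsum_eq, ← ENNReal.tsum_mul_left, ENNReal.tsum_prod']
  refine tsum_congr fun g => tsum_congr fun f => ?_
  simp only [Fin.consEquiv, Fin.appendEquiv, Equiv.coe_fn_mk, Fin.sum_univ_succ, Fin.prod_univ_succ,
    Fin.cons_zero, Fin.cons_succ, equivSigmaTuple_mk, size_node_ofFn, gwProb_node_ofFn,
    Fin.sum_univ_add, Fin.prod_univ_add, Fin.append_left, Fin.append_right, mul_ite, mul_zero,
    mul_assoc]
  exact if_congr (by omega) rfl rfl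

open PowerSeries in
theorem PowerSeries.coeff_X_mul_derivative {R : Type*} [CommRing R] (f : R⟦X⟧) (n : ℕ) :
    coeff n (X * d⁄dX R f) = n * coeff n f := by
  cases n with
  | zero => simp
  | succ n =>
    rw [coeff_succ_X_mul, coeff_derivative, mul_comm]
    push_cast
    rfl

open PowerSeries in
theorem PowerSeries.sum_antidiagonal_mul_coeff_mul_coeff_pow {R : Type*} [CommRing R]
    (f : R⟦X⟧) (n m : ℕ) :
    (n + 1) * ∑ x ∈ Finset.HasAntidiagonal.antidiagonal m,
        (x.1 : R) * coeff x.1 f * coeff x.2 (f ^ n) =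
      m * coeff m (f ^ (n + 1)) := by
  simp_rw [← coeff_X_mul_derivative, ← coeff_mul, derivative_pow]
  have : ((n : R) + 1) = ((n + 1 : ℕ) : R) := by push_cast; rfl
  rw [this, ← nsmul_eq_mul, ← map_nsmul, nsmul_eq_mul]
  congr 1
  simp only [Nat.add_sub_cancel]
  ring

/-- The generating function of a sequence of probabilities. -/
noncomputable def genFun (p : ℕ → ℝ≥0∞) : PowerSeries ℝ := .mk fun k => (p k).toReal

open PowerSeries in
theorem PowerSeries.coeff_mul_nonneg {f g : ℝ⟦X⟧} (hf : ∀ k, 0 ≤ coeff k f)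
    (hg : ∀ k, 0 ≤ coeff k g) (m : ℕ) : 0 ≤ coeff m (f * g) := by
  rw [coeff_mul]
  exact Finset.sum_nonneg fun x _ => mul_nonneg (hf _) (hg _)

open PowerSeries in
theorem PowerSeries.coeff_pow_nonneg {f : ℝ⟦X⟧} (hf : ∀ k, 0 ≤ coeff k f) (n : ℕ) :
    ∀ m, 0 ≤ coeff m (f ^ n) := by
  induction n with
  | zero =>
    intro m
    rw [pow_zero, coeff_one]
    split_ifs <;> norm_num
  | succ n ih =>
    rw [pow_succ]
    exact coeff_mul_nonneg ih hf

theorem coeff_genFun (p : ℕ → ℝ≥0∞) (k : ℕ) : (genFun p).coeff k = (p k).toReal :=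
  PowerSeries.coeff_mk _ _

theorem coeff_genFun_nonneg (p : ℕ → ℝ≥0∞) (k : ℕ) : 0 ≤ (genFun p).coeff k := by
  rw [coeff_genFun]
  exact ENNReal.toReal_nonneg

/-- The Otter–Dwass formula: the total progeny of `l` individuals is `l + m` with probability
`l / (l + m)` times the probability that `l + m` independent offspring numbers add up to `m`. -/
theorem probTotalProgeny_eq_coeff (p : ℕ → ℝ≥0∞) (hp : ∀ k, p k ≠ ⊤) {n : ℕ} (hn : 1 ≤ n) :
    ∀ l m : ℕ, l + m = n →
      probTotalProgeny p l n = ENNReal.ofReal (l / n * (genFun p ^ n).coeff m) := by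
  have hp' : ∀ k, p k = ENNReal.ofReal ((genFun p).coeff k) := fun k => by
    rw [coeff_genFun, ENNReal.ofReal_toReal (hp k)]
  induction n, hn using Nat.le_induction with
  | base =>
    intro l m h
    cases l with
    | zero => simp [probTotalProgeny_zero_succ p 0]
    | succ l =>
      obtain ⟨rfl, rfl⟩ : l = 0 ∧ m = 0 := by omega
      rw [probTotalProgeny_succ_succ p 0 0, tsum_eq_single 0, probTotalProgeny_zero_zero, hp' 0]
      · simp
      · intro k hk
        rw [probTotalProgeny_of_lt _ (by omega), mul_zero]
  | succ n hn ih =>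
    intro l m h
    cases l with
    | zero => simp [probTotalProgeny_zero_succ p n]
    | succ l =>
      have hterm : ∀ k ∈ Finset.range (m + 1), p k * probTotalProgeny p (k + l) n =
          ENNReal.ofReal ((genFun p).coeff k *
            (((k + l : ℕ) : ℝ) / n * (genFun p ^ n).coeff (m - k))) := fun k hk => by
        rw [Finset.mem_range] at hk
        rw [ENNReal.ofReal_mul (coeff_genFun_nonneg p k), ih (k + l) (m - k) (by omega), hp' k]
      rw [probTotalProgeny_succ_succ, tsum_eq_sum (s := Finset.range (m + 1)),
        Finset.sum_congr rfl hterm, ← ENNReal.ofReal_sum_of_nonneg]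
      · congr 1
        rw [← Finset.Nat.sum_antidiagonal_eq_sum_range_succ (fun i j => (genFun p).coeff i *
          (((i + l : ℕ) : ℝ) / n * (genFun p ^ n).coeff j))]
        have h1 := PowerSeries.sum_antidiagonal_mul_coeff_mul_coeff_pow (genFun p) n m
        have h2 := PowerSeries.coeff_mul m (genFun p) (genFun p ^ n)
        rw [← pow_succ'] at h2
        have hsplit : ∑ x ∈ Finset.HasAntidiagonal.antidiagonal m, (genFun p).coeff x.1 *
            (((x.1 + l : ℕ) : ℝ) / n * (genFun p ^ n).coeff x.2) =
            (∑ x ∈ Finset.HasAntidiagonal.antidiagonal m, (x.1 : ℝ) * (genFun p).coeff x.1 *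
              (genFun p ^ n).coeff x.2 + l * (genFun p ^ (n + 1)).coeff m) / n := by
          rw [h2, Finset.mul_sum, ← Finset.sum_add_distrib, Finset.sum_div]
          refine Finset.sum_congr rfl fun x _ => ?_
          push_cast
          ring
        rw [hsplit]
        have hn0 : (n : ℝ) ≠ 0 := by positivity
        have hn1 : (n : ℝ) + 1 ≠ 0 := by positivity
        have hnl : (n : ℝ) = l + m := by exact_mod_cast (by omega : n = l + m)
        rw [mul_comm ((n : ℝ) + 1), ← eq_div_iff hn1] at h1
        rw [h1]
        push_cast
        field_simp
        rw [hnl]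
        ring
      · exact fun k _ => mul_nonneg (coeff_genFun_nonneg p k) (mul_nonneg (by positivity)
          (PowerSeries.coeff_pow_nonneg (coeff_genFun_nonneg p) _ _))
      · intro k hk
        rw [Finset.mem_range] at hk
        rw [probTotalProgeny_of_lt _ (by omega), mul_zero]

theorem Nat.centralBinom_sq_mul_le (k : ℕ) : k.centralBinom ^ 2 * (2 * k + 1) ≤ 16 ^ k := by
  induction k with
  | zero => simp
  | succ k ih =>
    have h := Nat.succ_mul_centralBinom_succ k
    refine Nat.le_of_mul_le_mul_left (c := (k + 1) ^ 2) ?_ (by positivity)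
    calc (k + 1) ^ 2 * ((k + 1).centralBinom ^ 2 * (2 * (k + 1) + 1))
        = ((k + 1) * (k + 1).centralBinom) ^ 2 * (2 * k + 3) := by ring
      _ = (k.centralBinom ^ 2 * (2 * k + 1)) * (4 * ((2 * k + 1) * (2 * k + 3))) := by rw [h]; ring
      _ ≤ 16 ^ k * (16 * (k + 1) ^ 2) := Nat.mul_le_mul ih (by nlinarith)
      _ = (k + 1) ^ 2 * 16 ^ (k + 1) := by ring

theorem Nat.choose_sq_mul_le (j i : ℕ) : j.choose i ^ 2 * (j + 1) ≤ 4 ^ j := by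
  obtain ⟨k, rfl | rfl⟩ := Nat.even_or_odd' j
  · calc (2 * k).choose i ^ 2 * (2 * k + 1) ≤ k.centralBinom ^ 2 * (2 * k + 1) := by
          gcongr
          exact Nat.choose_le_centralBinom i k
      _ ≤ 16 ^ k := Nat.centralBinom_sq_mul_le k
      _ = 4 ^ (2 * k) := by rw [pow_mul]; norm_num
  · have h1 : (2 * k + 1).choose i ≤ (2 * k + 1).choose k := by
      have := Nat.choose_le_middle i (2 * k + 1)
      rwa [show (2 * k + 1) / 2 = k by omega] at this
    have h2 : (k + 1).centralBinom = 2 * (2 * k + 1).choose k := by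
      rw [Nat.centralBinom_eq_two_mul_choose, show 2 * (k + 1) = (2 * k + 1) + 1 by ring,
        Nat.choose_succ_succ, Nat.choose_symm_half]
      ring
    have h3 := Nat.centralBinom_sq_mul_le (k + 1)
    rw [h2] at h3
    have h4 : (2 * k + 1).choose i ^ 2 ≤ (2 * k + 1).choose k ^ 2 := Nat.pow_le_pow_left h1 2
    have h5 : 4 ^ (2 * k + 1) = 4 * 16 ^ k := by rw [pow_succ, pow_mul]; norm_num; ring
    rw [pow_succ 16] at h3
    rw [h5]
    calc (2 * k + 1).choose i ^ 2 * (2 * k + 1 + 1)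
        ≤ (2 * k + 1).choose k ^ 2 * (2 * (k + 1) + 1) := Nat.mul_le_mul h4 (by omega)
      _ ≤ 4 * 16 ^ k := by linarith

theorem choose_le_two_pow_div_sqrt (j i : ℕ) :
    (j.choose i : ℝ) ≤ 2 ^ j / √((j : ℝ) + 1) := by
  rw [le_div_iff₀ (by positivity)]
  refine le_of_sq_le_sq ?_ (by positivity)
  rw [mul_pow, Real.sq_sqrt (by positivity), ← pow_mul, mul_comm j, pow_mul]
  norm_num
  exact_mod_cast Nat.choose_sq_mul_le j i

namespace PowerSeries

theorem sum_range_coeff_mul_le {f g : ℝ⟦X⟧} (hf : ∀ k, 0 ≤ coeff k f)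
    (hg : ∀ k, 0 ≤ coeff k g) (M : ℕ) :
    ∑ i ∈ Finset.range M, coeff i (f * g) ≤
      (∑ i ∈ Finset.range M, coeff i f) * ∑ i ∈ Finset.range M, coeff i g := by
  simp_rw [coeff_mul]
  rw [Finset.sum_mul_sum, ← Finset.sum_product', ← Finset.sum_biUnion]
  · refine Finset.sum_le_sum_of_subset_of_nonneg ?_ fun x _ _ => mul_nonneg (hf _) (hg _)
    intro x
    simp only [Finset.mem_biUnion, Finset.mem_range, Finset.HasAntidiagonal.mem_antidiagonal,
      Finset.mem_product]
    rintro ⟨i, hi, rfl⟩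
    omega
  · intro i _ j _ hij
    rw [Function.onFun, Finset.disjoint_left]
    intro x
    simp only [Finset.HasAntidiagonal.mem_antidiagonal]
    omega

theorem sum_range_coeff_pow_le {f : ℝ⟦X⟧} (hf : ∀ k, 0 ≤ coeff k f) {z : ℝ}
    (hz : ∀ M, ∑ i ∈ Finset.range M, coeff i f ≤ z) (n M : ℕ) :
    ∑ i ∈ Finset.range M, coeff i (f ^ n) ≤ z ^ n := by
  have hz0 : 0 ≤ z := by simpa using hz 0
  induction n with
  | zero =>
    simp only [pow_zero, coeff_one, Finset.sum_ite_eq']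
    split_ifs <;> norm_num
  | succ n ih =>
    rw [pow_succ, pow_succ]
    refine (sum_range_coeff_mul_le (coeff_pow_nonneg hf n) hf M).trans ?_
    exact mul_le_mul ih (hz M) (Finset.sum_nonneg fun i _ => hf i) (by positivity)

theorem coeff_mul_le_mul_sum {f g : ℝ⟦X⟧} {B : ℝ} (hf : ∀ k, coeff k f ≤ B)
    (hg : ∀ k, 0 ≤ coeff k g) (m : ℕ) :
    coeff m (f * g) ≤ B * ∑ i ∈ Finset.range (m + 1), coeff i g := by
  rw [mul_comm, coeff_mul, Finset.Nat.sum_antidiagonal_eq_sum_range_succ_mk, Finset.mul_sum]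
  refine Finset.sum_le_sum fun i _ => ?_
  rw [mul_comm]
  exact mul_le_mul_of_nonneg_right (hf _) (hg _)

theorem coeff_one_add_X_pow_pow_le {b : ℕ} (hb : 1 ≤ b) (j k : ℕ) :
    coeff k ((1 + X ^ b : ℝ⟦X⟧) ^ j) ≤ 2 ^ j / √((j : ℝ) + 1) := by
  have hterm : ∀ i, coeff k (((X : ℝ⟦X⟧) ^ b) ^ i * 1 ^ (j - i) * (j.choose i : ℝ⟦X⟧)) =
      if k = b * i then (j.choose i : ℝ) else 0 := fun i => by
    rw [one_pow, mul_one, ← pow_mul, mul_comm, ← nsmul_eq_mul, map_nsmul, coeff_X_pow]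
    simp
  rw [add_comm, add_pow, map_sum, Finset.sum_congr rfl fun i _ => hterm i]
  by_cases hk : ∃ i, k = b * i
  · obtain ⟨i, rfl⟩ := hk
    have : ∀ x, b * i = b * x ↔ i = x := fun x =>
      ⟨fun h => Nat.eq_of_mul_eq_mul_left hb h, fun h => by rw [h]⟩
    simp_rw [this, Finset.sum_ite_eq]
    split_ifs
    · exact choose_le_two_pow_div_sqrt j i
    · positivity
  · push Not at hk
    simp_rw [if_neg (hk _), Finset.sum_const_zero]
    positivity

end PowerSeries

theorem sum_binomial_div_succ_le {θ z : ℝ} (hθ : 0 < θ) (hz : 0 ≤ z) (n : ℕ) :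
    ∑ j ∈ Finset.range (n + 1), θ ^ j * z ^ (n - j) * (n.choose j : ℝ) / ((j : ℝ) + 1) ≤
      (θ + z) ^ (n + 1) / (θ * (n + 1)) := by
  rw [le_div_iff₀ (by positivity), Finset.sum_mul, add_pow θ z (n + 1),
    Finset.sum_range_succ' _ (n + 1)]
  refine le_add_of_le_of_nonneg ?_ (by positivity)
  refine Finset.sum_le_sum fun j _ => le_of_eq ?_
  have h : ((n : ℝ) + 1) * n.choose j = (n + 1).choose (j + 1) * ((j : ℝ) + 1) := by
    exact_mod_cast Nat.add_one_mul_choose_eq n j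
  rw [Nat.add_sub_add_right, div_mul_eq_mul_div, div_eq_iff (by positivity)]
  linear_combination θ ^ (j + 1) * z ^ (n - j) * h

theorem sum_binomial_div_sqrt_le {θ z : ℝ} (hθ : 0 < θ) (hz : 0 ≤ z) (hle : θ + z ≤ 1) (n : ℕ) :
    ∑ j ∈ Finset.range (n + 1), θ ^ j * z ^ (n - j) * (n.choose j : ℝ) / √((j : ℝ) + 1) ≤
      (1 / θ + 1) / 2 * (θ + z) ^ n / √((n : ℝ) + 1) := by
  set r := √((n : ℝ) + 1) with hr
  have hr0 : 0 < r := by positivity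
  have hr2 : r ^ 2 = n + 1 := Real.sq_sqrt (by positivity)
  have key : ∀ j : ℕ, 1 / √((j : ℝ) + 1) ≤ r / 2 * (1 / ((j : ℝ) + 1)) + 1 / (2 * r) := fun j => by
    set s := √((j : ℝ) + 1) with hs
    have hs0 : 0 < s := by positivity
    have hs2 : s ^ 2 = j + 1 := Real.sq_sqrt (by positivity)
    rw [← hs2]
    have : r / 2 * (1 / s ^ 2) + 1 / (2 * r) - 1 / s = (r - s) ^ 2 / (2 * r * s ^ 2) := by
      field_simp
      ring
    have : 0 ≤ (r - s) ^ 2 / (2 * r * s ^ 2) := by positivity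
    linarith
  calc _ ≤ ∑ j ∈ Finset.range (n + 1), (r / 2 * (θ ^ j * z ^ (n - j) * (n.choose j : ℝ) /
          ((j : ℝ) + 1)) + 1 / (2 * r) * (θ ^ j * z ^ (n - j) * (n.choose j : ℝ))) := by
        refine Finset.sum_le_sum fun j _ => ?_
        have := mul_le_mul_of_nonneg_left (key j)
          (by positivity : 0 ≤ θ ^ j * z ^ (n - j) * (n.choose j : ℝ))
        refine (le_of_eq ?_).trans (this.trans (le_of_eq ?_)) <;> ring
    _ ≤ r / 2 * ((θ + z) ^ (n + 1) / (θ * (n + 1))) + 1 / (2 * r) * (θ + z) ^ n := by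
        rw [Finset.sum_add_distrib, ← Finset.mul_sum, ← Finset.mul_sum, ← add_pow]
        gcongr
        exact sum_binomial_div_succ_le hθ hz n
    _ ≤ r / 2 * ((θ + z) ^ n / (θ * (n + 1))) + 1 / (2 * r) * (θ + z) ^ n := by
        gcongr _ * (?_ / _) + _
        exact pow_le_pow_of_le_one (by positivity) hle (Nat.le_succ n)
    _ = (1 / θ + 1) / 2 * (θ + z) ^ n / r := by
        rw [← hr2]
        field_simp

open PowerSeries in
/-- A quantitative anticoncentration estimate: a power series with nonnegative coefficients of
total mass `Z ≤ 1`, two of which are at least `η`, has an `n`-th power whose coefficients are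
`O(Z ^ n / √n)`. -/
theorem PowerSeries.coeff_pow_le_div_sqrt {f : PowerSeries ℝ} (hf : ∀ k, 0 ≤ f.coeff k) {Z η : ℝ}
    (hsum : ∀ M, ∑ i ∈ Finset.range M, f.coeff i ≤ Z) (hZ : Z ≤ 1) (hη : 0 < η) {b : ℕ}
    (hb : 1 ≤ b) (h0 : η ≤ f.coeff 0) (hfb : η ≤ f.coeff b) (n m : ℕ) :
    (f ^ n).coeff m ≤ (1 / (2 * η) + 1) / 2 * Z ^ n / √((n : ℝ) + 1) := by
  set g : PowerSeries ℝ := f - C η * (1 + X ^ b) with hg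
  have hgc : ∀ k, g.coeff k = f.coeff k - (if k = 0 then η else 0) - (if k = b then η else 0) := by
    intro k
    simp [hg, coeff_C, coeff_X_pow, mul_add, sub_add_eq_sub_sub]
  have hg0 : ∀ k, 0 ≤ g.coeff k := by
    intro k
    rw [hgc]
    have := hf k
    split_ifs with h1 h2 h2
    · omega
    · subst h1; linarith
    · subst h2; linarith
    · linarith
  have hgsum : ∀ M, ∑ i ∈ Finset.range M, g.coeff i ≤ Z - 2 * η := by
    intro M
    have hmono : ∑ i ∈ Finset.range M, g.coeff i ≤ ∑ i ∈ Finset.range (M + b + 1), g.coeff i :=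
      Finset.sum_le_sum_of_subset_of_nonneg (Finset.range_mono (by omega)) fun i _ _ => hg0 i
    refine hmono.trans ?_
    have := hsum (M + b + 1)
    simp_rw [hgc, Finset.sum_sub_distrib, Finset.sum_ite_eq', Finset.mem_range]
    rw [if_pos (by omega), if_pos (by omega)]
    linarith
  have hz : 0 ≤ Z - 2 * η := by simpa using hgsum 0
  have hfg : f = C η * (1 + X ^ b) + g := by rw [hg]; ring
  have hterm : ∀ j, coeff m ((C η * (1 + X ^ b)) ^ j * g ^ (n - j) * (n.choose j : ℝ⟦X⟧)) ≤
      (2 * η) ^ j * (Z - 2 * η) ^ (n - j) * (n.choose j : ℝ) / √((j : ℝ) + 1) := by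
    intro j
    have h1 := coeff_mul_le_mul_sum (coeff_one_add_X_pow_pow_le hb j)
      (coeff_pow_nonneg hg0 (n - j)) m
    have h2 : coeff m ((1 + X ^ b) ^ j * g ^ (n - j)) ≤
        2 ^ j / √((j : ℝ) + 1) * (Z - 2 * η) ^ (n - j) :=
      h1.trans (mul_le_mul_of_nonneg_left (sum_range_coeff_pow_le hg0 hgsum _ _) (by positivity))
    have h3 : (C η * (1 + X ^ b)) ^ j * g ^ (n - j) * (n.choose j : ℝ⟦X⟧) =
        C (η ^ j * n.choose j) * ((1 + X ^ b) ^ j * g ^ (n - j)) := by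
      rw [map_mul, map_pow, map_natCast, mul_pow]
      ring
    rw [h3, coeff_C_mul]
    refine (mul_le_mul_of_nonneg_left h2 (by positivity)).trans (le_of_eq ?_)
    rw [mul_pow]
    ring
  rw [hfg, add_pow, map_sum]
  refine (Finset.sum_le_sum fun j _ => hterm j).trans ?_
  have := sum_binomial_div_sqrt_le (by positivity : 0 < 2 * η) hz (by linarith) n
  rwa [add_sub_cancel] at this

theorem Real.exp_neg_le_one_sub_add_sq {y : ℝ} (hy : -1 ≤ y) : Real.exp (-y) ≤ 1 - y + y ^ 2 := by
  rcases le_or_gt y 1 with h | h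
  · have := (abs_le.1 (Real.abs_exp_sub_one_sub_id_le (x := -y) (by rw [abs_le]; constructor <;>
      linarith))).2
    rw [neg_sq] at this
    linarith
  · have : Real.exp (-y) ≤ 1 := Real.exp_le_one_iff.2 (by linarith)
    nlinarith

section Moments

variable {a : ℕ → ℝ} {v : ℝ}

theorem summable_mul_exp_neg (ha : ∀ k, 0 ≤ a k) (h0 : HasSum a 1) {s : ℝ} (hs : 0 ≤ s) :
    Summable fun k => Real.exp (-s) ^ k * a k := by
  refine Summable.of_nonneg_of_le (fun k => mul_nonneg (by positivity) (ha k)) (fun k => ?_)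
    h0.summable
  exact mul_le_of_le_one_left (ha k)
    (pow_le_one₀ (by positivity) (Real.exp_le_one_iff.2 (by linarith)))

theorem exp_mul_tsum_mul_exp_neg_le (ha : ∀ k, 0 ≤ a k) (h0 : HasSum a 1)
    (h1 : HasSum (fun k : ℕ => (k : ℝ) * a k) 1)
    (h2 : HasSum (fun k : ℕ => a k * ((k : ℝ) - 1) ^ 2) v)
    {s : ℝ} (hs : 0 ≤ s) (hs1 : s ≤ 1) :
    Real.exp s * ∑' k, Real.exp (-s) ^ k * a k ≤ Real.exp (v * s ^ 2) := by
  have hL := (summable_mul_exp_neg ha h0 hs).hasSum.mul_left (Real.exp s)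
  have hR := (h0.sub ((h1.sub h0).mul_left s)).add (h2.mul_left (s ^ 2))
  refine (hasSum_le (fun k => ?_) hL hR).trans ?_
  · have hk : -1 ≤ s * ((k : ℝ) - 1) := by nlinarith [(Nat.cast_nonneg k : (0 : ℝ) ≤ k)]
    have h := mul_le_mul_of_nonneg_left (Real.exp_neg_le_one_sub_add_sq hk) (ha k)
    have he : Real.exp (-(s * ((k : ℝ) - 1))) = Real.exp s * Real.exp (-s) ^ k := by
      rw [← Real.exp_nat_mul, ← Real.exp_add]
      congr 1
      ring
    rw [he] at h
    linarith
  · have := Real.add_one_le_exp (v * s ^ 2)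
    linarith

end Moments

section Offspring

variable {p : ℕ → ℝ≥0∞}

theorem hasSum_toReal_of_tsum_ne_top {f : ℕ → ℝ≥0∞} (h : ∑' k, f k ≠ ⊤) :
    HasSum (fun k => (f k).toReal) (∑' k, f k).toReal := by
  rw [ENNReal.tsum_toReal_eq fun k => ENNReal.ne_top_of_tsum_ne_top h k]
  exact (ENNReal.summable_toReal h).hasSum

theorem hasSum_coeff_genFun (hp : ∑' k : ℕ, p k = 1) : HasSum (fun k => (genFun p).coeff k) 1 := by
  have := hasSum_toReal_of_tsum_ne_top (f := p) (by simp [hp])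
  simpa [hp, coeff_genFun] using this

theorem hasSum_mul_coeff_genFun (hmean : ∑' k : ℕ, (k : ℝ≥0∞) * p k = 1) :
    HasSum (fun k : ℕ => (k : ℝ) * (genFun p).coeff k) 1 := by
  have := hasSum_toReal_of_tsum_ne_top (f := fun k : ℕ => (k : ℝ≥0∞) * p k) (by simp [hmean])
  simpa [hmean, coeff_genFun] using this

theorem hasSum_coeff_genFun_mul_sq (hvar : xiVar p ≠ ⊤) :
    HasSum (fun k : ℕ => (genFun p).coeff k * ((k : ℝ) - 1) ^ 2) (xiVar p).toReal := by
  have := hasSum_toReal_of_tsum_ne_top hvar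
  simpa [xiVar, coeff_genFun, ENNReal.toReal_ofReal, sq_nonneg] using this

theorem coeff_genFun_zero_pos (hp : ∑' k : ℕ, p k = 1)
    (hmean : ∑' k : ℕ, (k : ℝ≥0∞) * p k = 1) (hvar_pos : 0 < xiVar p) (hvar_fin : xiVar p ≠ ⊤) :
    0 < (genFun p).coeff 0 := by
  refine (coeff_genFun_nonneg p 0).lt_of_ne' fun h0 => ?_
  have hs := (hasSum_mul_coeff_genFun hmean).sub (hasSum_coeff_genFun hp)
  have hnn : ∀ k : ℕ, 0 ≤ (k : ℝ) * (genFun p).coeff k - (genFun p).coeff k := by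
    intro k
    cases k with
    | zero => simp [h0]
    | succ k =>
      have := mul_nonneg (Nat.cast_nonneg (α := ℝ) k) (coeff_genFun_nonneg p (k + 1))
      push_cast
      linarith
  rw [sub_self, hasSum_zero_iff_of_nonneg hnn] at hs
  have hv : (xiVar p).toReal = 0 := by
    rw [← (hasSum_coeff_genFun_mul_sq hvar_fin).tsum_eq]
    refine (tsum_congr fun k => ?_).trans tsum_zero
    have := congrFun hs k
    simp only [Pi.zero_apply] at this
    linear_combination ((k : ℝ) - 1) * this
  exact (ENNReal.toReal_pos hvar_pos.ne' hvar_fin).ne' hv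

theorem exists_coeff_genFun_pos (hmean : ∑' k : ℕ, (k : ℝ≥0∞) * p k = 1) :
    ∃ b, 1 ≤ b ∧ 0 < (genFun p).coeff b := by
  by_contra! h
  have h0 : ∀ k : ℕ, (k : ℝ) * (genFun p).coeff k = 0 := fun k => by
    rcases Nat.eq_zero_or_pos k with rfl | hk
    · simp
    · rw [le_antisymm (h k hk) (coeff_genFun_nonneg p k), mul_zero]
  have := hasSum_mul_coeff_genFun hmean
  simp_rw [h0] at this
  exact one_ne_zero (this.unique hasSum_zero)

/-- A local large deviation bound for the lower tail of a sum of `n` independent copies of the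
offspring variable, obtained by exponential tilting. -/
theorem exists_coeff_genFun_pow_le (hp : ∑' k : ℕ, p k = 1)
    (hmean : ∑' k : ℕ, (k : ℝ≥0∞) * p k = 1) (hvar_pos : 0 < xiVar p) (hvar_fin : xiVar p ≠ ⊤) :
    ∃ K c : ℝ, 0 < K ∧ 0 < c ∧ ∀ n l m : ℕ, 1 ≤ n → l + m = n →
      (genFun p ^ n).coeff m ≤ K / √(n : ℝ) * Real.exp (-c * l ^ 2 / n) := by
  obtain ⟨b, hb, hpb⟩ := exists_coeff_genFun_pos hmean
  have hp0 := coeff_genFun_zero_pos hp hmean hvar_pos hvar_fin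
  set v := (xiVar p).toReal
  have hv : 0 ≤ v := ENNReal.toReal_nonneg
  set η := Real.exp (-(b : ℝ)) * min ((genFun p).coeff 0) ((genFun p).coeff b) with hη
  have hη0 : 0 < η := mul_pos (Real.exp_pos _) (lt_min hp0 hpb)
  set K := (1 / (2 * η) + 1) / 2
  set δ := 1 / (1 + 2 * v) with hδ
  have hδ0 : 0 < δ := by positivity
  have hδ1 : δ ≤ 1 := (div_le_one (by positivity)).2 (by linarith)
  have hδv : δ * v ≤ 1 / 2 := by
    rw [hδ, div_mul_eq_mul_div, div_le_div_iff₀ (by positivity) (by norm_num)]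
    linarith
  refine ⟨K, δ / 2, by positivity, by positivity, fun n l m hn hlm => ?_⟩
  have hn0 : (0 : ℝ) < n := by exact_mod_cast hn
  have hln : (l : ℝ) + m = n := by exact_mod_cast hlm
  have hm0 : (0 : ℝ) ≤ m := Nat.cast_nonneg m
  set s := δ * (l / n) with hs
  have hs0 : 0 ≤ s := by positivity
  have hs1 : s ≤ 1 := mul_le_one₀ hδ1 (by positivity) ((div_le_one hn0).2 (by linarith))
  have hsum := summable_mul_exp_neg (coeff_genFun_nonneg p) (hasSum_coeff_genFun hp) hs0
  set Z := ∑' k, Real.exp (-s) ^ k * (genFun p).coeff k with hZ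
  have hterm0 : ∀ k, 0 ≤ Real.exp (-s) ^ k * (genFun p).coeff k :=
    fun k => mul_nonneg (by positivity) (coeff_genFun_nonneg p k)
  have hZ0 : 0 ≤ Z := tsum_nonneg hterm0
  have hZ1 : Z ≤ 1 := hasSum_le (fun k => mul_le_of_le_one_left (coeff_genFun_nonneg p k)
    (pow_le_one₀ (by positivity) (Real.exp_le_one_iff.2 (by linarith)))) hsum.hasSum
    (hasSum_coeff_genFun hp)
  have hZexp : Real.exp s * Z ≤ Real.exp (v * s ^ 2) :=
    exp_mul_tsum_mul_exp_neg_le (coeff_genFun_nonneg p) (hasSum_coeff_genFun hp)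
      (hasSum_mul_coeff_genFun hmean) (hasSum_coeff_genFun_mul_sq hvar_fin) hs0 hs1
  have hcon := PowerSeries.coeff_pow_le_div_sqrt
    (f := PowerSeries.rescale (Real.exp (-s)) (genFun p)) (Z := Z) (η := η)
    (by simpa only [PowerSeries.coeff_rescale] using hterm0)
    (by simpa only [PowerSeries.coeff_rescale] using fun M =>
      hsum.sum_le_tsum (Finset.range M) fun k _ => hterm0 k)
    hZ1 hη0 hb
    (by
      rw [PowerSeries.coeff_rescale, pow_zero]
      exact mul_le_mul (Real.exp_le_one_iff.2 (by simp)) (min_le_left _ _)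
        (lt_min hp0 hpb).le zero_le_one)
    (by
      rw [PowerSeries.coeff_rescale, ← Real.exp_nat_mul]
      refine mul_le_mul (Real.exp_le_exp.2 ?_) (min_le_right _ _)
        (lt_min hp0 hpb).le (Real.exp_pos _).le
      nlinarith [(Nat.cast_nonneg b : (0 : ℝ) ≤ b)]) n m
  rw [← map_pow, PowerSeries.coeff_rescale] at hcon
  have hexp : Real.exp (s * m) * Real.exp (-s) ^ m = 1 := by
    rw [← Real.exp_nat_mul, ← Real.exp_add, ← Real.exp_zero]
    congr 1
    ring
  calc (genFun p ^ n).coeff m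
      = Real.exp (s * m) * (Real.exp (-s) ^ m * (genFun p ^ n).coeff m) := by
        rw [← mul_assoc, hexp, one_mul]
    _ ≤ Real.exp (s * m) * (K * Z ^ n / √((n : ℝ) + 1)) := by gcongr
    _ ≤ Real.exp (s * m) * (K * Z ^ n / √(n : ℝ)) := by
        gcongr
        linarith
    _ = K / √(n : ℝ) * ((Real.exp s * Z) ^ n * Real.exp (-(s * l))) := by
        have : Real.exp (s * m) = Real.exp s ^ n * Real.exp (-(s * l)) := by
          rw [← Real.exp_nat_mul, ← Real.exp_add, ← hln]
          congr 1
          ring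
        rw [this, mul_pow]
        ring
    _ ≤ K / √(n : ℝ) * (Real.exp (v * s ^ 2) ^ n * Real.exp (-(s * l))) := by gcongr
    _ ≤ K / √(n : ℝ) * Real.exp (-(δ / 2) * l ^ 2 / n) := by
        rw [← Real.exp_nat_mul, ← Real.exp_add]
        gcongr
        have h1 : (n : ℝ) * (v * s ^ 2) + -(s * l) = -(δ * (1 - δ * v)) * (l ^ 2 / n) := by
          rw [hs]
          field_simp
          ring
        rw [h1, mul_div_assoc]
        gcongr
        nlinarith

end Offspring

theorem Real.mul_exp_neg_mul_sq_le {c : ℝ} (hc : 0 < c) (x : ℝ) :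
    x * Real.exp (-c * x ^ 2) ≤ 1 + 1 / c := by
  rw [neg_mul, Real.exp_neg, ← div_eq_mul_inv, div_le_iff₀ (Real.exp_pos _)]
  have h := Real.add_one_le_exp (c * x ^ 2)
  have h1 : (1 + 1 / c) * (c * x ^ 2 + 1) = x ^ 2 + 1 + (c * x ^ 2 + 1 / c) := by
    field_simp
    ring
  have h2 : (1 + 1 / c) * (c * x ^ 2 + 1) ≤ (1 + 1 / c) * Real.exp (c * x ^ 2) := by gcongr
  have h3 : 0 ≤ c * x ^ 2 + 1 / c := by positivity
  nlinarith [sq_nonneg (x - 1)]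

/-- part of Lemma 1 of Devroye–Janson.  There are constants
`C, c > 0` with `P(W_ℓ = n) ≤ C ℓ n^{-3/2} exp(-c ℓ²/n)` for all `ℓ, n ≥ 1`; in
particular `P(W_ℓ = n) ≤ C' / n` for some constant `C'`. -/
theorem probTotalProgeny_le
    (p : ℕ → ℝ≥0∞) (hp : ∑' k : ℕ, p k = 1)
    (hmean : ∑' k : ℕ, (k : ℝ≥0∞) * p k = 1)
    (hvar_pos : 0 < xiVar p) (hvar_fin : xiVar p ≠ ⊤) :
    (∃ C c : ℝ, 0 < C ∧ 0 < c ∧ ∀ l n : ℕ, 1 ≤ l → 1 ≤ n →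
        probTotalProgeny p l n
          ≤ ENNReal.ofReal (C * l * (n : ℝ) ^ (-(3 : ℝ) / 2) *
              Real.exp (-c * l ^ 2 / n))) ∧
      ∃ C' : ℝ, 0 < C' ∧ ∀ l n : ℕ, 1 ≤ l → 1 ≤ n →
        probTotalProgeny p l n ≤ ENNReal.ofReal (C' / n) := by
  obtain ⟨K, c, hK, hc, hKc⟩ := exists_coeff_genFun_pow_le hp hmean hvar_pos hvar_fin
  have hpow : ∀ n : ℕ, 1 ≤ n → (n : ℝ) ^ (-(3 : ℝ) / 2) = 1 / (n * √(n : ℝ)) := fun n hn => by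
    have hn0 : (0 : ℝ) < n := by exact_mod_cast hn
    rw [show -(3 : ℝ) / 2 = -(1 + 1 / 2) by norm_num, Real.rpow_neg hn0.le, Real.rpow_add hn0,
      Real.rpow_one, ← Real.sqrt_eq_rpow, one_div]
  have hbound : ∀ l n : ℕ, 1 ≤ l → 1 ≤ n → probTotalProgeny p l n ≤ ENNReal.ofReal
      (K * l * (n : ℝ) ^ (-(3 : ℝ) / 2) * Real.exp (-c * l ^ 2 / n)) := by
    intro l n _ hn
    rcases lt_or_ge n l with h | h
    · simp [probTotalProgeny_of_lt p h]
    · rw [probTotalProgeny_eq_coeff p (ENNReal.ne_top_of_tsum_ne_top (by simp [hp])) hn l (n - l)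
        (by omega), hpow n hn]
      refine ENNReal.ofReal_le_ofReal ?_
      calc _ ≤ (l : ℝ) / n * (K / √(n : ℝ) * Real.exp (-c * l ^ 2 / n)) :=
            mul_le_mul_of_nonneg_left (hKc n l (n - l) hn (by omega)) (by positivity)
        _ = _ := by ring
  refine ⟨⟨K, c, hK, hc, hbound⟩, K * (1 + 1 / c), by positivity, fun l n hl hn => ?_⟩
  refine (hbound l n hl hn).trans (ENNReal.ofReal_le_ofReal ?_)
  have hn0 : (0 : ℝ) < n := by exact_mod_cast hn
  have h := Real.mul_exp_neg_mul_sq_le hc (l / √(n : ℝ))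
  rw [div_pow, Real.sq_sqrt hn0.le, ← mul_div_assoc] at h
  calc _ = K / n * (l / √(n : ℝ) * Real.exp (-c * l ^ 2 / n)) := by
        rw [hpow n hn]
        ring
    _ ≤ K / n * (1 + 1 / c) := by gcongr
    _ = _ := by ring
end
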